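/- Let u be a stable regular solution of −Δ_p u = f(u) in the unit ball B₁ ⊂ ℝⁿ, with f ∈ C¹(ℝ), and let a < n. Then there is a positive constant C, depending only on n, p, and a, such that for every ρ ∈ (0, 2/3): (n−p−a) ∫_{B_ρ} r^{−a} |∇u|^p dx + (pa − a²/4) ∫_{B_ρ} r^{−a} |∇u|^{p−2} u_r² dx − (a²/4)(p−2) ∫_{B_ρ} r^{−a} |∇u|^{p−4} u_r⁴ dx ≤ C ∫_{B_{3ρ/2} \ B_ρ} r^{−a} |∇u|^p dx. -/

import Mathlib

open MeasureTheory Metric Set Filter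
open scoped RealInnerProductSpace

noncomputable section

abbrev Euc (n : ℕ) := EuclideanSpace ℝ (Fin n)

/-- `u` is a regular solution of `−Δ_p u = f(u)` in the open set `U ⊆ ℝⁿ`:
`u ∈ C¹(U)`, `f ∘ u ∈ L^∞(U)`, and the equation holds in the weak sense against
all `C¹` test functions with compact support in `U`. -/
def IsRegularSolution (n : ℕ) (p : ℝ) (U : Set (Euc n)) (f : ℝ → ℝ) (u : Euc n → ℝ) : Prop :=
  ContDiffOn ℝ 1 u U ∧
  (∃ C : ℝ, ∀ x ∈ U, |f (u x)| ≤ C) ∧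
  ∀ ξ : Euc n → ℝ, ContDiff ℝ 1 ξ → HasCompactSupport ξ → tsupport ξ ⊆ U →
    ∫ x in U, ‖gradient u x‖ ^ (p - 2) * ⟪gradient u x, gradient ξ x⟫
      = ∫ x in U, f (u x) * ξ x

/-- `u` is a stable regular solution of `−Δ_p u = f(u)` in `U`: the second variation of the
energy is nonnegative on all Lipschitz test functions with compact support in `U`. -/
def IsStableRegularSolution (n : ℕ) (p : ℝ) (U : Set (Euc n)) (f : ℝ → ℝ)
    (u : Euc n → ℝ) : Prop :=
  IsRegularSolution n p U f u ∧
  ∀ ξ : Euc n → ℝ, (∃ K, LipschitzWith K ξ) → HasCompactSupport ξ → tsupport ξ ⊆ U →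
    0 ≤ (∫ x in U ∩ {y | 0 < ‖gradient u y‖},
          (‖gradient u x‖ ^ (p - 2) * ‖gradient ξ x‖ ^ 2
            + (p - 2) * ‖gradient u x‖ ^ (p - 4) * ⟪gradient u x, gradient ξ x⟫ ^ 2))
        - ∫ x in U, deriv f (u x) * ξ x ^ 2

/-- The radial derivative `u_r(x) = (x/|x|)·∇u(x)` (junk value `0` at `x = 0`). -/
def radialDeriv {n : ℕ} (u : Euc n → ℝ) (x : Euc n) : ℝ := ⟪x, gradient u x⟫ / ‖x‖

/-- The dimension condition (★): `n < p + 4p/(p−1)` if `p ≥ 2`, and `n < 5p` if `1 < p < 2`. -/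
def DimensionCondition (n : ℕ) (p : ℝ) : Prop :=
  (2 ≤ p → (n : ℝ) < p + 4 * p / (p - 1)) ∧ (p < 2 → (n : ℝ) < 5 * p)

lemma abs_sub_taylor_two_le {F f : ℝ → ℝ} {a d κ η : ℝ} (hκ : 0 ≤ κ)
    (hF : ∀ z, |z - a| ≤ η → HasDerivAt F (f z) z)
    (hf : ∀ z, |z - a| ≤ η → |f z - f a - d * (z - a)| ≤ κ * |z - a|)
    {z : ℝ} (hz : |z - a| ≤ η) :
    |F z - F a - f a * (z - a) - d / 2 * (z - a) ^ 2| ≤ κ * (z - a) ^ 2 := by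
  have hsub : ∀ w ∈ uIcc a z, |w - a| ≤ |z - a| := fun w hw => abs_sub_left_of_mem_uIcc hw
  have key := (convex_uIcc a z).norm_image_sub_le_of_norm_hasDerivWithin_le
    (f := fun w => F w - f a * (w - a) - d / 2 * (w - a) ^ 2)
    (f' := fun w => f w - f a - d * (w - a)) (C := κ * |z - a|) (x := a) (y := z)
    (fun w hw => by
      have h1 := hF w ((hsub w hw).trans hz)
      have h2 := ((hasDerivAt_id w).sub_const a)
      have h3 := (h1.sub (h2.const_mul (f a))).sub ((h2.pow 2).const_mul (d / 2))
      refine (h3.congr_deriv ?_).hasDerivWithinAt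
      simp; ring)
    (fun w hw => by
      rw [Real.norm_eq_abs]
      exact (hf w ((hsub w hw).trans hz)).trans
        (mul_le_mul_of_nonneg_left (hsub w hw) hκ))
    left_mem_uIcc right_mem_uIcc
  have e : κ * |z - a| * ‖z - a‖ = κ * (z - a) ^ 2 := by
    rw [Real.norm_eq_abs, mul_assoc, ← sq, sq_abs]
  rw [e, Real.norm_eq_abs] at key
  convert key using 2
  simp; ring

lemma exists_taylor_two_rpow (q : ℝ) {κ : ℝ} (hκ : 0 < κ) :
    ∃ η > 0, ∀ y : ℝ, |y| ≤ η →
      |(1 + y) ^ q - 1 - q * y - q * (q - 1) / 2 * y ^ 2| ≤ κ * y ^ 2 := by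
  have hd : HasDerivAt (fun z : ℝ => q * z ^ (q - 1)) (q * (q - 1)) 1 := by
    simpa using (Real.hasDerivAt_rpow_const (x := 1) (p := q - 1) (Or.inl one_ne_zero)).const_mul q
  have ho := (hasDerivAt_iff_isLittleO.1 hd).def hκ
  obtain ⟨η, hη, h⟩ := Metric.eventually_nhds_iff_ball.1 ho
  refine ⟨min (η / 2) (1 / 2), by positivity, fun y hy => ?_⟩
  have := abs_sub_taylor_two_le (F := fun z : ℝ => z ^ q) (f := fun z => q * z ^ (q - 1))
    (a := 1) (d := q * (q - 1)) (κ := κ) (η := min (η / 2) (1 / 2)) hκ.le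
    (fun z hz => by
      have : |z - 1| ≤ 1 / 2 := hz.trans (min_le_right _ _)
      have : 0 < z := by linarith [abs_le.1 this]
      exact Real.hasDerivAt_rpow_const (Or.inl this.ne'))
    (fun z hz => by
      have h1 : |z - 1| ≤ η / 2 := hz.trans (min_le_left _ _)
      have h2 := h z (by rw [mem_ball, Real.dist_eq]; linarith)
      simp only [Real.norm_eq_abs, smul_eq_mul] at h2
      convert h2 using 2
      ring)
    (z := 1 + y) (by simpa using hy)
  simpa using this

lemma bregman_scalar_bound {p κ c x β y R : ℝ} (hp : 0 < p) (hκ : 0 ≤ κ) (hc : 0 ≤ c)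
    (hx0 : 0 ≤ x) (hβx : |β| ≤ x) (hx1 : x ≤ 1) (hx : x * (10 * (|p - 2| + 1)) ≤ κ * c)
    (hA : c * x ^ 2 ≤ x ^ 2 + (p - 2) * β ^ 2) (hy : y = 2 * β + x ^ 2) (hy2 : y ^ 2 ≤ 9 * x ^ 2)
    (hR : -(p * (κ * c) / 36 * y ^ 2) ≤ R - 1 - p / 2 * y - p / 2 * (p / 2 - 1) / 2 * y ^ 2) :
    (1 - κ) * (x ^ 2 + (p - 2) * β ^ 2) ≤ 2 * ((R - 1) / p - β) := by
  have h1 : y / 2 + (p - 2) / 8 * y ^ 2 - κ * c / 36 * y ^ 2 ≤ (R - 1) / p := by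
    rw [le_div_iff₀ hp]; linarith
  have h2 : |(p - 2) * (4 * β * x ^ 2 + x ^ 4)| ≤ κ * c / 2 * x ^ 2 := by
    rw [abs_mul]
    have h3 : |4 * β * x ^ 2 + x ^ 4| ≤ 5 * x * x ^ 2 := by
      have hx4 : x ^ 4 ≤ x * x ^ 2 := by
        have := mul_le_mul_of_nonneg_right hx1 (by positivity : 0 ≤ x ^ 3)
        linarith
      have := mul_le_mul_of_nonneg_right (abs_le.1 hβx).2 (sq_nonneg x)
      have := mul_le_mul_of_nonneg_right (abs_le.1 hβx).1 (sq_nonneg x)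
      have : 0 ≤ x ^ 4 := by positivity
      rw [abs_le]; constructor <;> linarith
    calc |p - 2| * |4 * β * x ^ 2 + x ^ 4| ≤ |p - 2| * (5 * x * x ^ 2) := by gcongr
      _ = (x * (10 * |p - 2|)) / 2 * x ^ 2 := by ring
      _ ≤ κ * c / 2 * x ^ 2 := by gcongr ?_ / 2 * _; linarith
  have h4 := (abs_le.1 h2).1
  have h5 : κ * (c * x ^ 2) ≤ κ * (x ^ 2 + (p - 2) * β ^ 2) := by gcongr
  have h6 : κ * c * y ^ 2 ≤ κ * c * (9 * x ^ 2) := by gcongr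
  have h7 : 0 ≤ κ * c * x ^ 2 := by positivity
  have h8 : y ^ 2 = 4 * β ^ 2 + (4 * β * x ^ 2 + x ^ 4) := by rw [hy]; ring
  have h9 : (p - 2) * y ^ 2 = 4 * (p - 2) * β ^ 2 + (p - 2) * (4 * β * x ^ 2 + x ^ 4) := by
    rw [h8]; ring
  linarith

section Bregman
variable {V : Type*} [NormedAddCommGroup V] [InnerProductSpace ℝ V]

lemma bregman_nonneg {p : ℝ} (hp : 1 < p) (v w : V) :
    0 ≤ ‖w‖ ^ p / p - ‖v‖ ^ p / p - ‖v‖ ^ (p - 2) * ⟪v, w - v⟫ := by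
  have hp0 : 0 < p := by linarith
  rcases eq_or_ne v 0 with rfl | hv
  · simp [Real.zero_rpow hp0.ne']; positivity
  have hv' : 0 < ‖v‖ := norm_pos_iff.2 hv
  have hq : p.HolderConjugate (p / (p - 1)) := Real.HolderConjugate.conjExponent hp
  have young := Real.young_inequality_of_nonneg (norm_nonneg w)
    (Real.rpow_nonneg (norm_nonneg v) (p - 1)) hq
  have e1 : (‖v‖ ^ (p - 1)) ^ (p / (p - 1)) = ‖v‖ ^ p := by
    rw [← Real.rpow_mul hv'.le, mul_div_cancel₀ _ (by linarith)]
  have e2 : ‖v‖ ^ (p - 2) * ‖v‖ = ‖v‖ ^ (p - 1) := by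
    rw [← Real.rpow_add_one hv'.ne']; congr 1; ring
  have e3 : ‖v‖ ^ (p - 1) * ‖v‖ = ‖v‖ ^ p := by
    rw [← Real.rpow_add_one hv'.ne']; congr 1; ring
  have e4 : ‖v‖ ^ p / (p / (p - 1)) = ‖v‖ ^ p - ‖v‖ ^ p / p := by
    have : p - 1 ≠ 0 := by linarith
    field_simp
  have h5 : ‖v‖ ^ (p - 2) * ⟪v, w⟫ ≤ ‖v‖ ^ (p - 2) * (‖v‖ * ‖w‖) :=
    mul_le_mul_of_nonneg_left (real_inner_le_norm v w) (by positivity)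
  rw [inner_sub_right, real_inner_self_eq_norm_sq]
  rw [e1, e4] at young
  have h6 : ‖v‖ ^ (p - 2) * ‖v‖ ^ 2 = ‖v‖ ^ p := by rw [sq, ← mul_assoc, e2, e3]
  have h7 : ‖v‖ ^ (p - 2) * (‖v‖ * ‖w‖) = ‖w‖ * ‖v‖ ^ (p - 1) := by rw [← mul_assoc, e2]; ring
  rw [mul_sub, h6]
  linarith

lemma secondVariation_nonneg {p : ℝ} (hp : 1 < p) (v h : V) (hv : v ≠ 0) :
    0 ≤ ‖v‖ ^ (p - 2) * ‖h‖ ^ 2 + (p - 2) * ‖v‖ ^ (p - 4) * ⟪v, h⟫ ^ 2 := by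
  have hv' : 0 < ‖v‖ := norm_pos_iff.2 hv
  have e : ‖v‖ ^ (p - 2) = ‖v‖ ^ (p - 4) * ‖v‖ ^ 2 := by
    rw [← Real.rpow_natCast, ← Real.rpow_add hv']; congr 1; norm_num; ring
  have h1 : ⟪v, h⟫ ^ 2 ≤ ‖v‖ ^ 2 * ‖h‖ ^ 2 := by
    rw [← mul_pow, sq_le_sq, abs_of_nonneg (by positivity : 0 ≤ ‖v‖ * ‖h‖)]
    exact abs_real_inner_le_norm v h
  have : 0 ≤ ‖v‖ ^ (p - 4) := by positivity
  rw [e]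
  have : 0 ≤ ‖v‖ ^ (p - 4) * (‖v‖ ^ 2 * ‖h‖ ^ 2 + (p - 2) * ⟪v, h⟫ ^ 2) := by
    apply mul_nonneg this
    nlinarith [sq_nonneg ⟪v, h⟫]
  linarith

/-- Near a nonzero vector the Bregman divergence of `‖·‖ ^ p / p` is bounded below by its second
order Taylor term. -/
lemma exists_secondVariation_le_bregman {p : ℝ} (hp : 1 < p) {κ : ℝ} (hκ : 0 < κ) :
    ∃ η > 0, ∀ v h : V, v ≠ 0 → ‖h‖ ≤ η * ‖v‖ →
      (1 - κ) * (‖v‖ ^ (p - 2) * ‖h‖ ^ 2 + (p - 2) * ‖v‖ ^ (p - 4) * ⟪v, h⟫ ^ 2)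
        ≤ 2 * (‖v + h‖ ^ p / p - ‖v‖ ^ p / p - ‖v‖ ^ (p - 2) * ⟪v, h⟫) := by
  have hp0 : 0 < p := by linarith
  obtain ⟨c, hc0, hc1, hcp⟩ : ∃ c : ℝ, 0 < c ∧ c ≤ 1 ∧ c ≤ p - 1 :=
    ⟨min 1 (p - 1), lt_min one_pos (by linarith), min_le_left _ _, min_le_right _ _⟩
  obtain ⟨η₀, hη₀, H⟩ := exists_taylor_two_rpow (p / 2) (κ := p * (κ * c) / 36) (by positivity)
  set η := min (min (η₀ / 3) 1) (κ * c / (10 * (|p - 2| + 1))) with hη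
  have hηpos : 0 < η := by positivity
  refine ⟨η, hηpos, fun v h hv hh => ?_⟩
  have hv' : 0 < ‖v‖ := norm_pos_iff.2 hv
  set x := ‖h‖ / ‖v‖ with hx
  set β := ⟪v, h⟫ / ‖v‖ ^ 2 with hβ
  have hx0 : 0 ≤ x := by positivity
  have hxη : x ≤ η := by rw [hx, div_le_iff₀ hv']; exact hh
  have hβx : |β| ≤ x := by
    rw [hβ, hx, abs_div, abs_of_pos (by positivity : 0 < ‖v‖ ^ 2), div_le_div_iff₀ (by positivity) hv']
    nlinarith [abs_real_inner_le_norm v h]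
  have hx1 : x ≤ 1 := hxη.trans ((min_le_left _ _).trans (min_le_right _ _))
  have hx2 : x ≤ η₀ / 3 := hxη.trans ((min_le_left _ _).trans (min_le_left _ _))
  have hx3 : x * (10 * (|p - 2| + 1)) ≤ κ * c := by
    rw [← le_div_iff₀ (by positivity)]; exact hxη.trans (min_le_right _ _)
  set y := 2 * β + x ^ 2 with hy
  have hyx : |y| ≤ 3 * x := by
    have := abs_le.1 hβx
    rw [abs_le]; constructor <;> nlinarith
  have hT := (abs_le.1 (H y (by linarith))).1
  have eh : ‖h‖ = x * ‖v‖ := by rw [hx]; field_simp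
  have eβ : ⟪v, h⟫ = β * ‖v‖ ^ 2 := by rw [hβ]; field_simp
  have esum : ‖v + h‖ ^ p = ‖v‖ ^ p * (1 + y) ^ (p / 2) := by
    have h1 : ‖v + h‖ ^ 2 = ‖v‖ ^ 2 * (1 + y) := by
      rw [norm_add_sq_real, eβ, eh, hy]; ring
    have h2 : 0 ≤ 1 + y := by
      by_contra hneg
      push Not at hneg
      nlinarith [sq_nonneg ‖v + h‖, sq_pos_of_pos hv']
    have h3 : ‖v + h‖ ^ p = (‖v + h‖ ^ 2) ^ (p / 2) := by
      rw [← Real.rpow_natCast, ← Real.rpow_mul (norm_nonneg _)]; congr 1; push_cast; ring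
    have h4 : ‖v‖ ^ p = (‖v‖ ^ 2) ^ (p / 2) := by
      rw [← Real.rpow_natCast, ← Real.rpow_mul (norm_nonneg _)]; congr 1; push_cast; ring
    rw [h3, h1, Real.mul_rpow (by positivity) h2, h4]
  have e2 : ‖v‖ ^ (p - 2) * ‖v‖ ^ 2 = ‖v‖ ^ p := by
    rw [← Real.rpow_natCast, ← Real.rpow_add hv']; congr 1; norm_num
  have e4 : ‖v‖ ^ (p - 4) * ‖v‖ ^ 4 = ‖v‖ ^ p := by
    rw [← Real.rpow_natCast, ← Real.rpow_add hv']; congr 1; norm_num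
  have eL : ‖v‖ ^ (p - 2) * ‖h‖ ^ 2 + (p - 2) * ‖v‖ ^ (p - 4) * ⟪v, h⟫ ^ 2
      = ‖v‖ ^ p * (x ^ 2 + (p - 2) * β ^ 2) := by
    rw [eh, eβ, mul_pow, mul_pow]
    linear_combination (x ^ 2) * e2 + (p - 2) * β ^ 2 * e4
  have eR : ‖v + h‖ ^ p / p - ‖v‖ ^ p / p - ‖v‖ ^ (p - 2) * ⟪v, h⟫
      = ‖v‖ ^ p * (((1 + y) ^ (p / 2) - 1) / p - β) := by
    rw [esum, eβ]
    linear_combination (-β) * e2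
  rw [eL, eR]
  have hβ2 : β ^ 2 ≤ x ^ 2 := by rw [← sq_abs]; gcongr
  have hA : c * x ^ 2 ≤ x ^ 2 + (p - 2) * β ^ 2 := by
    rcases le_total 2 p with h2 | h2
    · have := mul_le_mul_of_nonneg_right hc1 (sq_nonneg x)
      have := mul_nonneg (sub_nonneg.2 h2) (sq_nonneg β)
      linarith
    · have := mul_le_mul_of_nonneg_right hcp (sq_nonneg x)
      have := mul_le_mul_of_nonneg_left hβ2 (sub_nonneg.2 h2)
      linarith
  have hy2 : y ^ 2 ≤ 9 * x ^ 2 := by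
    have := pow_le_pow_left₀ (abs_nonneg y) hyx 2
    rw [sq_abs] at this; linarith [this, (by ring : (3 * x) ^ 2 = 9 * x ^ 2)]
  have := bregman_scalar_bound hp0 hκ.le hc0.le hx0 hβx hx1 hx3 hA hy hy2 hT
  have hV : 0 ≤ ‖v‖ ^ p := by positivity
  linarith [mul_le_mul_of_nonneg_left this hV]
end Bregman

lemma exists_smooth_threshold {δ : ℝ} (hδ : 0 < δ) :
    ∃ T : ℝ → ℝ, ContDiff ℝ 1 T ∧ T 0 = 0 ∧ (∀ s, |deriv T s| ≤ 1) ∧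
      (∀ s, |s| ≤ δ → deriv T s = 0) ∧ ∀ s, |T s - s| ≤ 4 * δ := by
  obtain ⟨b, hb1, hb2⟩ : ∃ b : ContDiffBump (0 : ℝ), b.rIn = δ ∧ b.rOut = 2 * δ :=
    ⟨⟨δ, 2 * δ, hδ, by linarith⟩, rfl, rfl⟩
  have hc : Continuous fun s => 1 - b s := continuous_const.sub b.continuous
  have hD : ∀ s, HasDerivAt (fun s => ∫ σ in (0 : ℝ)..s, (1 - b σ)) (1 - b s) s := fun s =>
    hc.integral_hasStrictDerivAt 0 s |>.hasDerivAt
  have hD' : deriv (fun s => ∫ σ in (0 : ℝ)..s, (1 - b σ)) = fun s => 1 - b s :=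
    funext fun s => (hD s).deriv
  refine ⟨fun s => ∫ σ in (0 : ℝ)..s, (1 - b σ), ?_, by simp, fun s => ?_, fun s hs => ?_,
    fun s => ?_⟩
  · rw [contDiff_one_iff_deriv, hD']
    exact ⟨fun s => (hD s).differentiableAt, hc⟩
  · rw [hD', abs_le]
    constructor <;> linarith [b.nonneg (x := s), b.le_one (x := s)]
  · rw [hD']
    simp only [sub_eq_zero]
    exact (b.one_of_mem_closedBall (by simpa [hb1] using hs)).symm
  · have h1 : (∫ σ in (0 : ℝ)..s, (1 - b σ)) - s = - ∫ σ in (0 : ℝ)..s, b σ := by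
      rw [intervalIntegral.integral_sub (by simp) (b.continuous.intervalIntegrable _ _)]
      simp
    simp only [h1, abs_neg]
    calc |∫ σ in (0 : ℝ)..s, b σ| ≤ ∫ σ in uIoc 0 s, ‖b σ‖ := by
          simpa using intervalIntegral.norm_integral_le_integral_norm_uIoc (f := b) (a := 0) (b := s)
      _ ≤ ∫ σ, ‖b σ‖ := setIntegral_le_integral b.integrable.norm (by filter_upwards; simp)
      _ = ∫ σ, b σ := by simp [abs_of_nonneg b.nonneg]
      _ ≤ (volume : Measure ℝ).real (closedBall 0 b.rOut) := b.integral_le_measure_closedBall volume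
      _ = 4 * δ := by simp [hb2, hδ.le]; ring

lemma exists_taylor_two_primitive {f : ℝ → ℝ} (hf : ContDiff ℝ 1 f) (M : ℝ) {κ : ℝ} (hκ : 0 < κ) :
    ∃ η > 0, ∀ a, |a| ≤ M → ∀ b, |b - a| ≤ η →
      |(∫ s in (0 : ℝ)..b, f s) - (∫ s in (0 : ℝ)..a, f s) - f a * (b - a)
        - deriv f a / 2 * (b - a) ^ 2| ≤ κ * (b - a) ^ 2 := by
  have hcd : Continuous (deriv f) := hf.continuous_deriv le_rfl
  have huc : UniformContinuousOn (deriv f) (Icc (-(M + 1)) (M + 1)) :=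
    isCompact_Icc.uniformContinuousOn_of_continuous hcd.continuousOn
  obtain ⟨η, hη, H⟩ := Metric.uniformContinuousOn_iff_le.1 huc κ hκ
  refine ⟨min η 1, by positivity, fun a ha b hb => ?_⟩
  have hd : ∀ z, |z - a| ≤ min η 1 → |deriv f z - deriv f a| ≤ κ := fun z hz => by
    have h1 := abs_le.1 ha
    have h2 := abs_le.1 (hz.trans (min_le_right _ _))
    exact H z ⟨by linarith, by linarith⟩ a ⟨by linarith, by linarith⟩ (hz.trans (min_le_left _ _))
  refine abs_sub_taylor_two_le (F := fun b => ∫ s in (0 : ℝ)..b, f s) hκ.le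
    (fun z _ => (hf.continuous.integral_hasStrictDerivAt 0 z).hasDerivAt) (fun z hz => ?_) hb
  have key := (convex_uIcc a z).norm_image_sub_le_of_norm_hasDerivWithin_le
    (f := fun w => f w - deriv f a * w) (f' := fun w => deriv f w - deriv f a) (C := κ) (x := a)
    (y := z)
    (fun w _ => by
      have h1 := ((hf.differentiable one_ne_zero) w).hasDerivAt
      have h2 := (hasDerivAt_id w).const_mul (deriv f a)
      exact ((h1.sub h2).congr_deriv (by simp)).hasDerivWithinAt)
    (fun w hw => hd w ((abs_sub_left_of_mem_uIcc hw).trans hz))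
    left_mem_uIcc right_mem_uIcc
  simp only [Real.norm_eq_abs] at key
  convert key using 2
  ring

section Gradient
variable {n : ℕ} {u w : Euc n → ℝ}

lemma ContDiff.continuous_gradient (hu : ContDiff ℝ 1 u) : Continuous (gradient u) :=
  (InnerProductSpace.toDual ℝ (Euc n)).symm.continuous.comp (hu.continuous_fderiv one_ne_zero)

lemma gradient_sub_apply (hu : ContDiff ℝ 1 u) (hw : ContDiff ℝ 1 w) (x : Euc n) :
    gradient (fun y => w y - u y) x = gradient w x - gradient u x := by
  simp only [gradient]
  rw [fderiv_fun_sub (hw.differentiable one_ne_zero x) (hu.differentiable one_ne_zero x), map_sub]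

lemma gradient_comp_apply {T : ℝ → ℝ} (hT : ContDiff ℝ 1 T) (hu : ContDiff ℝ 1 u) (x : Euc n) :
    gradient (fun y => T (u y)) x = deriv T (u x) • gradient u x := by
  simp only [gradient]
  have h := ((hT.differentiable one_ne_zero (u x)).hasDerivAt.comp_hasFDerivAt x
    (hu.differentiable one_ne_zero x).hasFDerivAt).fderiv
  rw [Function.comp_def] at h
  rw [h, map_smul]

lemma gradient_const_mul_apply (c : ℝ) (x : Euc n) (hu : ContDiff ℝ 1 u) :
    gradient (fun y => c * u y) x = c • gradient u x := by
  simp only [gradient]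
  rw [fderiv_const_mul (hu.differentiable one_ne_zero x), map_smul]

lemma HasCompactSupport.gradient (hu : HasCompactSupport u) : HasCompactSupport (gradient u) :=
  (hu.fderiv ℝ).comp_left (map_zero _)

end Gradient

section AlmostMinimality
variable {n : ℕ} {p : ℝ} {f : ℝ → ℝ} {u : Euc n → ℝ} {K : Set (Euc n)}

lemma norm_rpow_mul_inner_le (v h : Euc n) :
    |‖v‖ ^ (p - 2) * ⟪v, h⟫| ≤ ‖v‖ ^ (p - 1) * ‖h‖ := by
  rcases eq_or_ne v 0 with rfl | hv
  · simp; positivity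
  have hv' : 0 < ‖v‖ := norm_pos_iff.2 hv
  have e : ‖v‖ ^ (p - 1) = ‖v‖ ^ (p - 2) * ‖v‖ := by
    rw [← Real.rpow_add_one hv'.ne']; congr 1; ring
  rw [abs_mul, abs_of_nonneg (by positivity), e, mul_assoc]
  gcongr
  exact abs_real_inner_le_norm v h

lemma tsupport_subset_of_forall_notMem (hK : IsCompact K) {ξ : Euc n → ℝ}
    (h : ∀ x ∉ K, ξ x = 0) : tsupport ξ ⊆ K :=
  closure_minimal (fun x hx => by_contra fun hK => hx (h x hK)) hK.isClosed

lemma Continuous.integrable_of_forall_notMem (hK : IsCompact K) {ξ : Euc n → ℝ}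
    (hξ : Continuous ξ) (h : ∀ x ∉ K, ξ x = 0) : Integrable ξ :=
  hξ.integrable_of_hasCompactSupport (HasCompactSupport.intro hK h)

/-- A competitor `w` whose distance to `u` is controlled, through the stability inequality for
the test function `ξ`, has almost larger energy than `u`. -/
lemma le_energy_sub_of_test (hp : 1 < p) (hf : ContDiff ℝ 1 f) (hu : ContDiff ℝ 1 u)
    (hK : IsCompact K)
    (weak : ∀ ξ : Euc n → ℝ, ContDiff ℝ 1 ξ → tsupport ξ ⊆ K →
      ∫ x, ‖gradient u x‖ ^ (p - 2) * ⟪gradient u x, gradient ξ x⟫ = ∫ x, f (u x) * ξ x)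
    (stab : ∀ ξ : Euc n → ℝ, ContDiff ℝ 1 ξ → tsupport ξ ⊆ K →
      ∫ x, deriv f (u x) * ξ x ^ 2 ≤ ∫ x in {y | 0 < ‖gradient u y‖},
        (‖gradient u x‖ ^ (p - 2) * ‖gradient ξ x‖ ^ 2
          + (p - 2) * ‖gradient u x‖ ^ (p - 4) * ⟪gradient u x, gradient ξ x⟫ ^ 2))
    {w ξ : Euc n → ℝ} (hw : ContDiff ℝ 1 w) (hwK : ∀ x ∉ K, w x = u x)
    (hξ : ContDiff ℝ 1 ξ) (hξK : ∀ x ∉ K, ξ x = 0) {t κ ε : ℝ} (ht : t ≠ 0) (hκ : κ < 1)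
    (hQ : ∀ x, gradient u x ≠ 0 →
      (1 - κ) * (‖gradient u x‖ ^ (p - 2) * ‖gradient ξ x‖ ^ 2
        + (p - 2) * ‖gradient u x‖ ^ (p - 4) * ⟪gradient u x, gradient ξ x⟫ ^ 2)
      ≤ 2 / t ^ 2 * (‖gradient w x‖ ^ p / p - ‖gradient u x‖ ^ p / p
        - ‖gradient u x‖ ^ (p - 2) * ⟪gradient u x, gradient w x - gradient u x⟫))
    (hR : ∀ x ∈ K, -ε ≤ (1 - κ) * (deriv f (u x) * ξ x ^ 2)
      - 2 / t ^ 2 * ((∫ s in (0 : ℝ)..w x, f s) - (∫ s in (0 : ℝ)..u x, f s)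
        - f (u x) * (w x - u x))) :
    -(t ^ 2 / 2 * (ε * volume.real K)) ≤ ∫ x, ((‖gradient w x‖ ^ p - ‖gradient u x‖ ^ p) / p
      - ((∫ s in (0 : ℝ)..w x, f s) - ∫ s in (0 : ℝ)..u x, f s)) := by
  have hp0 : 0 < p := by linarith
  have hFc : Continuous fun z => ∫ s in (0 : ℝ)..z, f s :=
    continuous_iff_continuousAt.2 fun z =>
      (hf.continuous.integral_hasStrictDerivAt 0 z).hasDerivAt.continuousAt
  set F : ℝ → ℝ := fun z => ∫ s in (0 : ℝ)..z, f s with hF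
  have hgu := hu.continuous_gradient
  have hgw := hw.continuous_gradient
  have hgK : ∀ x ∉ K, gradient w x = gradient u x := fun x hx =>
    Filter.EventuallyEq.gradient_eq <| by
      filter_upwards [hK.isClosed.isOpen_compl.mem_nhds hx] with y hy using hwK y hy
  set G₁ : Euc n → ℝ := fun x => (‖gradient w x‖ ^ p - ‖gradient u x‖ ^ p) / p with hG₁
  set G₂ : Euc n → ℝ := fun x =>
    ‖gradient u x‖ ^ (p - 2) * ⟪gradient u x, gradient w x - gradient u x⟫ with hG₂
  set R : Euc n → ℝ := fun x => F (w x) - F (u x) - f (u x) * (w x - u x) with hRdef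
  have cG₁ : Continuous G₁ := by
    refine Continuous.div_const (Continuous.sub ?_ ?_) _
    · exact hgw.norm.rpow_const fun _ => Or.inr hp0.le
    · exact hgu.norm.rpow_const fun _ => Or.inr hp0.le
  have iG₁ : Integrable G₁ := cG₁.integrable_of_forall_notMem hK fun x hx => by
    simp [hG₁, hgK x hx]
  have iB : Integrable fun x => ‖gradient u x‖ ^ (p - 1) * ‖gradient w x - gradient u x‖ := by
    refine Continuous.integrable_of_forall_notMem hK ?_ fun x hx => by simp [hgK x hx]
    exact (hgu.norm.rpow_const fun _ => Or.inr (by linarith)).mul (hgw.sub hgu).norm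
  have iG₂ : Integrable G₂ := by
    refine iB.mono' ?_ (ae_of_all _ fun x => norm_rpow_mul_inner_le _ _)
    exact ((hgu.norm.measurable.pow_const _).mul (hgu.inner (hgw.sub hgu)).measurable)
      |>.aestronglyMeasurable
  have cR : Continuous R := by
    have := hf.continuous
    have := hu.continuous
    have := hw.continuous
    fun_prop
  have iR : Integrable R := cR.integrable_of_forall_notMem hK fun x hx => by
    simp [hRdef, hwK x hx]
  have iΔ : Integrable fun x => f (u x) * (w x - u x) := by
    refine Continuous.integrable_of_forall_notMem hK ?_ fun x hx => by simp [hwK x hx]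
    have := hf.continuous
    have := hu.continuous
    have := hw.continuous
    fun_prop
  have eG₂ : ∫ x, G₂ x = ∫ x, f (u x) * (w x - u x) := by
    rw [← weak (fun x => w x - u x) (hw.sub hu)
      (tsupport_subset_of_forall_notMem hK fun x hx => by simp [hwK x hx])]
    simp only [hG₂, gradient_sub_apply hu hw]
  have iD : Integrable fun x => G₁ x - G₂ x := iG₁.sub iG₂
  have hDnn : ∀ x, 0 ≤ G₁ x - G₂ x := fun x => by
    have := bregman_nonneg hp (gradient u x) (gradient w x)
    simp only [hG₁, hG₂, sub_div]; exact this
  have iS : Integrable fun x => deriv f (u x) * ξ x ^ 2 := by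
    refine Continuous.integrable_of_forall_notMem hK ?_ fun x hx => by simp [hξK x hx]
    have := hf.continuous_deriv le_rfl
    have := hu.continuous
    have := hξ.continuous
    fun_prop
  have hstab : (1 - κ) * ∫ x, deriv f (u x) * ξ x ^ 2 ≤ 2 / t ^ 2 * ∫ x, (G₁ x - G₂ x) := by
    have hS : MeasurableSet {y | 0 < ‖gradient u y‖} :=
      (isOpen_lt continuous_const hgu.norm).measurableSet
    refine (mul_le_mul_of_nonneg_left (stab ξ hξ (tsupport_subset_of_forall_notMem hK hξK))
      (by linarith)).trans ?_
    rw [← integral_const_mul, ← integral_const_mul]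
    refine le_trans ?_ (setIntegral_le_integral (s := {y | 0 < ‖gradient u y‖}) (iD.const_mul _)
      (ae_of_all _ fun x => mul_nonneg (by positivity) (hDnn x)))
    refine integral_mono_of_nonneg ?_ (iD.const_mul _).integrableOn ?_
    · filter_upwards [ae_restrict_mem hS] with x hx
      exact mul_nonneg (by linarith) (secondVariation_nonneg hp _ _ (norm_pos_iff.1 hx))
    · filter_upwards [ae_restrict_mem hS] with x hx
      have := hQ x (norm_pos_iff.1 hx)
      simp only [hG₁, hG₂, sub_div]; exact this
  have hlow : -(ε * volume.real K) ≤ ∫ x, ((1 - κ) * (deriv f (u x) * ξ x ^ 2)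
      - 2 / t ^ 2 * R x) := by
    have i1 : Integrable fun x => (1 - κ) * (deriv f (u x) * ξ x ^ 2) - 2 / t ^ 2 * R x :=
      (iS.const_mul _).sub (iR.const_mul _)
    rw [← setIntegral_eq_integral_of_forall_compl_eq_zero (s := K) (fun x hx => by
      simp [hξK x hx, hRdef, hwK x hx])]
    calc -(ε * volume.real K) = ∫ x in K, -ε := by simp [mul_comm]
      _ ≤ _ := setIntegral_mono_on (integrableOn_const hK.measure_lt_top.ne) i1.integrableOn
        hK.measurableSet fun x hx => hR x hx
  have e1 : ∫ x, (G₁ x - (F (w x) - F (u x))) = (∫ x, (G₁ x - G₂ x)) - ∫ x, R x := by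
    have i2 : Integrable fun x => F (w x) - F (u x) := by
      refine (iR.add iΔ).congr (ae_of_all _ fun x => ?_)
      simp [hRdef]
    rw [integral_sub iG₁ i2, integral_sub iG₁ iG₂, eG₂, hRdef]
    have : ∫ x, (F (w x) - F (u x)) = (∫ x, R x) + ∫ x, f (u x) * (w x - u x) := by
      rw [← integral_add iR iΔ]; simp [hRdef]
    rw [this]; ring
  rw [e1]
  rw [integral_sub (iS.const_mul _) (iR.const_mul _), integral_const_mul, integral_const_mul]
    at hlow
  have ht2 : 0 < t ^ 2 := by positivity
  have h3 := mul_le_mul_of_nonneg_left (hlow.trans (sub_le_sub_right hstab _))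
    (by positivity : 0 ≤ t ^ 2 / 2)
  have h4 : t ^ 2 / 2 * (2 / t ^ 2 * (∫ x, (G₁ x - G₂ x)) - 2 / t ^ 2 * ∫ x, R x)
      = (∫ x, (G₁ x - G₂ x)) - ∫ x, R x := by field_simp
  linarith

/-- Along a `C¹`-small variation `U t` of `u` whose speed is controlled by `‖∇u‖`, stability implies
that the energy decreases at most by `o(t²)`. -/
theorem eventually_neg_mul_sq_le_energy_sub (hp : 1 < p) (hf : ContDiff ℝ 1 f)
    (hu : ContDiff ℝ 1 u) (huc : HasCompactSupport u) (hK : IsCompact K)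
    (weak : ∀ ξ : Euc n → ℝ, ContDiff ℝ 1 ξ → tsupport ξ ⊆ K →
      ∫ x, ‖gradient u x‖ ^ (p - 2) * ⟪gradient u x, gradient ξ x⟫ = ∫ x, f (u x) * ξ x)
    (stab : ∀ ξ : Euc n → ℝ, ContDiff ℝ 1 ξ → tsupport ξ ⊆ K →
      ∫ x, deriv f (u x) * ξ x ^ 2 ≤ ∫ x in {y | 0 < ‖gradient u y‖},
        (‖gradient u x‖ ^ (p - 2) * ‖gradient ξ x‖ ^ 2
          + (p - 2) * ‖gradient u x‖ ^ (p - 4) * ⟪gradient u x, gradient ξ x⟫ ^ 2))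
    {U : ℝ → Euc n → ℝ} {C : ℝ} (hC : 0 < C)
    (hU : ∀ᶠ t in nhdsWithin 0 {0}ᶜ, ContDiff ℝ 1 (U t) ∧ ∀ x ∉ K, U t x = u x)
    (hU₀ : ∀ η > 0, ∀ᶠ t in nhdsWithin 0 {0}ᶜ, ∀ x,
      |U t x - u x| ≤ |t| * (C * ‖gradient u x‖ + η))
    (hU₁ : ∀ η > 0, ∀ᶠ t in nhdsWithin 0 {0}ᶜ, ∀ x, ‖gradient (U t) x - gradient u x‖ ≤ η)
    {ε : ℝ} (hε : 0 < ε) :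
    ∀ᶠ t in nhdsWithin 0 {0}ᶜ, -(ε * t ^ 2) ≤
      ∫ x, ((‖gradient (U t) x‖ ^ p - ‖gradient u x‖ ^ p) / p
        - ((∫ s in (0 : ℝ)..U t x, f s) - ∫ s in (0 : ℝ)..u x, f s)) := by
  have hgu := hu.continuous_gradient
  obtain ⟨M, hM⟩ := huc.exists_bound_of_continuous hu.continuous
  obtain ⟨L, hL⟩ := (huc.gradient).exists_bound_of_continuous hgu
  obtain ⟨M', hM'⟩ := hK.exists_bound_of_continuousOn
    ((hf.continuous_deriv le_rfl).comp hu.continuous).continuousOn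
  have hL0 : 0 ≤ L := (norm_nonneg _).trans (hL 0)
  set C₀ := C * L + 1 with hC₀
  have hC₀pos : 0 < C₀ := by positivity
  set B := |M'| * ((C₀ + 4) ^ 2 + 4 * (2 * C₀ + 4)) + 2 * C₀ ^ 2 with hB
  have hBpos : 0 < B := by positivity
  obtain ⟨κ, hκ0, hκ1, hκB⟩ : ∃ κ : ℝ, 0 < κ ∧ κ ≤ 1 / 2 ∧ κ * B * volume.real K ≤ 2 * ε := by
    have hk : 0 ≤ B * volume.real K := by positivity
    refine ⟨min (1 / 2) (2 * ε / (B * volume.real K + 1)), by positivity, min_le_left _ _, ?_⟩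
    rw [mul_assoc]
    calc _ ≤ 2 * ε / (B * volume.real K + 1) * (B * volume.real K) := by
          gcongr; exact min_le_right _ _
      _ ≤ 2 * ε / (B * volume.real K + 1) * (B * volume.real K + 1) := by gcongr; linarith
      _ = 2 * ε := by field_simp
  obtain ⟨η₁, hη₁, hBreg⟩ := exists_secondVariation_le_bregman (V := Euc n) hp hκ0
  obtain ⟨η₂, hη₂, hTay⟩ := exists_taylor_two_primitive hf M hκ0
  obtain ⟨T, hT, hT0, hT1, hTδ, hTs⟩ := exists_smooth_threshold hκ0
  have hsmall : ∀ᶠ t : ℝ in nhdsWithin 0 {0}ᶜ, |t| * C₀ ≤ η₂ := by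
    have : Tendsto (fun t : ℝ => |t| * C₀) (nhds 0) (nhds 0) :=
      (by fun_prop : Continuous fun t : ℝ => |t| * C₀).tendsto' 0 0 (by simp)
    exact nhdsWithin_le_nhds (this.eventually (ge_mem_nhds hη₂))
  filter_upwards [hU, hU₀ 1 one_pos, hU₀ (κ / 2) (by positivity),
    hU₁ (η₁ * (κ / (2 * C))) (by positivity), hsmall, self_mem_nhdsWithin]
    with t ⟨hw, hwK⟩ h1 h2 h3 h4 ht
  have ht0 : t ≠ 0 := ht
  have ht' : 0 < |t| := abs_pos.2 ht0
  set q : Euc n → ℝ := fun x => t⁻¹ * (U t x - u x) with hq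
  have hqC : ContDiff ℝ 1 q := contDiff_const.mul (hw.sub hu)
  have hqt : ∀ x, t * q x = U t x - u x := fun x => by simp only [hq]; field_simp
  have hqabs : ∀ x, ∀ b, |U t x - u x| ≤ |t| * b → |q x| ≤ b := fun x b hb => by
    rw [← hqt, abs_mul] at hb; exact le_of_mul_le_mul_left hb ht'
  have hq0 : ∀ x, |q x| ≤ C₀ := fun x => (hqabs x _ (h1 x)).trans (by
    have := hL x; rw [hC₀]; gcongr)
  have hgξ : ∀ x, gradient (fun y => T (q y)) x
      = (deriv T (q x) * t⁻¹) • (gradient (U t) x - gradient u x) := fun x => by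
    rw [gradient_comp_apply hT hqC, hq, gradient_const_mul_apply _ _ (hw.sub hu),
      gradient_sub_apply hu hw, smul_smul]
  refine le_trans ?_ (le_energy_sub_of_test hp hf hu hK weak stab hw hwK (hT.comp hqC)
    (t := t) (κ := κ) (ε := κ * B) (fun x hx => by simp [hq, hwK x hx, hT0]) ht0 (by linarith)
    (fun x hx => ?_) (fun x hx => ?_))
  · have := mul_le_mul_of_nonneg_left hκB (by positivity : 0 ≤ t ^ 2 / 2)
    linarith
  · have hD := bregman_nonneg hp (gradient u x) (gradient (U t) x)
    have e : gradient (T ∘ q) x = _ := hgξ x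
    rw [e]
    rcases le_or_gt |q x| κ with hle | hgt
    · rw [hTδ _ hle]
      simp only [zero_mul, zero_smul, norm_zero, inner_zero_right]
      have : 0 ≤ 2 / t ^ 2 * (‖gradient (U t) x‖ ^ p / p - ‖gradient u x‖ ^ p / p
        - ‖gradient u x‖ ^ (p - 2) * ⟪gradient u x, gradient (U t) x - gradient u x⟫) := by
        positivity
      simpa using this
    · have hg : κ / (2 * C) ≤ ‖gradient u x‖ := by
        have := hqabs x _ (h2 x)
        rw [div_le_iff₀ (by positivity)]; linarith
      have hb := hBreg (gradient u x) (gradient (U t) x - gradient u x) hx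
        ((h3 x).trans (by gcongr))
      rw [add_sub_cancel] at hb
      have hs := secondVariation_nonneg hp (gradient u x) (gradient (U t) x - gradient u x) hx
      rw [norm_smul, inner_smul_right, mul_pow, mul_pow, Real.norm_eq_abs, sq_abs]
      set Q := ‖gradient u x‖ ^ (p - 2) * ‖gradient (U t) x - gradient u x‖ ^ 2 + (p - 2) *
        ‖gradient u x‖ ^ (p - 4) * ⟪gradient u x, gradient (U t) x - gradient u x⟫ ^ 2 with hQ
      have hc : (deriv T (q x) * t⁻¹) ^ 2 ≤ (t ^ 2)⁻¹ := by
        rw [mul_pow, inv_pow]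
        have : deriv T (q x) ^ 2 ≤ 1 := by rw [sq_le_one_iff_abs_le_one]; exact hT1 _
        exact mul_le_of_le_one_left (by positivity) this
      calc _ = (deriv T (q x) * t⁻¹) ^ 2 * ((1 - κ) * Q) := by rw [hQ]; ring
        _ ≤ (t ^ 2)⁻¹ * ((1 - κ) * Q) := by
          gcongr; exact mul_nonneg (by linarith) hs
        _ ≤ (t ^ 2)⁻¹ * _ := mul_le_mul_of_nonneg_left hb (by positivity)
        _ = _ := by rw [div_eq_mul_inv]; ring
  · have hTay' := (abs_le.1 (hTay (u x) (hM x) (U t x) (by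
      rw [← hqt, abs_mul]; exact (mul_le_mul_of_nonneg_left (hq0 x) ht'.le).trans h4))).2
    rw [← hqt] at hTay'
    set R := (∫ s in (0 : ℝ)..U t x, f s) - (∫ s in (0 : ℝ)..u x, f s) - f (u x) * (t * q x)
      with hR
    have hR' : 2 / t ^ 2 * R ≤ deriv f (u x) * q x ^ 2 + 2 * κ * q x ^ 2 := by
      rw [div_mul_eq_mul_div, div_le_iff₀ (by positivity)]; linarith
    rw [← hqt]
    have hd : |deriv f (u x)| ≤ |M'| := (hM' x hx).trans (le_abs_self _)
    have hTq := hTs (q x)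
    have hsq : |(1 - κ) * T (q x) ^ 2 - q x ^ 2| ≤ κ * ((C₀ + 4) ^ 2 + 4 * (2 * C₀ + 4)) := by
      have hT4 : |T (q x)| ≤ C₀ + 4 := by
        have := abs_sub_abs_le_abs_sub (T (q x)) (q x)
        have := hq0 x
        linarith
      have h5 : |T (q x) + q x| ≤ 2 * C₀ + 4 := (abs_add_le _ _).trans (by
        have := hq0 x
        linarith)
      calc |(1 - κ) * T (q x) ^ 2 - q x ^ 2|
          = |(T (q x) - q x) * (T (q x) + q x) - κ * T (q x) ^ 2| := by congr 1; ring
        _ ≤ |(T (q x) - q x) * (T (q x) + q x)| + |κ * T (q x) ^ 2| := abs_sub _ _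
        _ = |T (q x) - q x| * |T (q x) + q x| + κ * |T (q x)| ^ 2 := by
          rw [abs_mul, abs_mul, abs_of_pos hκ0, abs_pow]
        _ ≤ (4 * κ) * (2 * C₀ + 4) + κ * (C₀ + 4) ^ 2 := by gcongr
        _ = _ := by ring
    have h6 : |deriv f (u x) * ((1 - κ) * T (q x) ^ 2 - q x ^ 2)|
        ≤ |M'| * (κ * ((C₀ + 4) ^ 2 + 4 * (2 * C₀ + 4))) := by
      rw [abs_mul]; gcongr
    have h7 : 2 * κ * q x ^ 2 ≤ 2 * κ * C₀ ^ 2 := by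
      rw [← sq_abs (q x)]; gcongr; exact hq0 x
    have h8 := (abs_le.1 h6).1
    simp only [Function.comp]
    rw [hB]
    linarith

end AlmostMinimality

section
variable {n : ℕ}

lemma det_smul_id_add_smulRight [NeZero n] {m : ℝ} (hm : m ≠ 0) (μ : ℝ) (x : Euc n) :
    (m • ContinuousLinearMap.id ℝ (Euc n) + μ • (innerSL ℝ x).smulRight x).det
      = m ^ (n - 1) * (m + μ * ‖x‖ ^ 2) := by
  have h : ((m • ContinuousLinearMap.id ℝ (Euc n) + μ • (innerSL ℝ x).smulRight x :
      Euc n →L[ℝ] Euc n) : Euc n →ₗ[ℝ] Euc n)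
      = m • LinearMap.transvection ((μ / m) • (innerSL ℝ x : Euc n →ₗ[ℝ] ℝ)) x := by
    ext1 y
    simp only [LinearMap.transvection.apply, ContinuousLinearMap.coe_coe,
      _root_.add_apply, _root_.smul_apply, LinearMap.smul_apply,
      ContinuousLinearMap.smulRight_apply, innerSL_apply_apply, smul_add, smul_smul, smul_eq_mul,
      ContinuousLinearMap.id_apply]
    congr 2
    field_simp
  rw [ContinuousLinearMap.det, h, LinearMap.det_smul, LinearMap.transvection.det,
    finrank_euclideanSpace_fin]
  obtain ⟨k, rfl⟩ : ∃ k, n = k + 1 := Nat.exists_eq_succ_of_ne_zero (NeZero.ne n)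
  simp only [LinearMap.smul_apply, ContinuousLinearMap.coe_coe, innerSL_apply_apply,
    real_inner_self_eq_norm_sq, smul_eq_mul, Nat.add_sub_cancel]
  field_simp
  ring

lemma exists_homeomorph_of_norm_fderiv_sub_id_le {Ψ : Euc n → Euc n} (hΨ : ContDiff ℝ 1 Ψ)
    (h : ∀ x, ‖fderiv ℝ Ψ x - ContinuousLinearMap.id ℝ (Euc n)‖ ≤ 1 / 2)
    (hdet : ∀ x, (fderiv ℝ Ψ x).det ≠ 0) :
    ∃ e : Euc n ≃ₜ Euc n, ⇑e = Ψ ∧ ContDiff ℝ 1 e.symm := by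
  have hd := hΨ.differentiable one_ne_zero
  have happ : ApproximatesLinearOn Ψ
      ((ContinuousLinearEquiv.refl ℝ (Euc n) : Euc n ≃L[ℝ] Euc n) : Euc n →L[ℝ] Euc n) univ
      (1 / 2) := by
    intro x _ y _
    have key := (convex_univ (𝕜 := ℝ) (E := Euc n)).norm_image_sub_le_of_norm_hasFDerivWithin_le
      (f := fun z => Ψ z - z) (f' := fun z => fderiv ℝ Ψ z - ContinuousLinearMap.id ℝ (Euc n))
      (C := 1 / 2) (x := y) (y := x)
      (fun z _ => ((hd z).hasFDerivAt.sub (hasFDerivAt_id z)).hasFDerivWithinAt)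
      (fun z _ => h z) (mem_univ _) (mem_univ _)
    have : Ψ x - x - (Ψ y - y) = Ψ x - Ψ y - (x - y) := by abel
    rw [this] at key
    simpa using key
  have hc : Subsingleton (Euc n) ∨ (1 / 2 : NNReal) <
      ‖((ContinuousLinearEquiv.refl ℝ (Euc n)).symm : Euc n →L[ℝ] Euc n)‖₊⁻¹ := by
    rcases subsingleton_or_nontrivial (Euc n) with hs | hs
    · exact Or.inl hs
    · right
      have : ‖((ContinuousLinearEquiv.refl ℝ (Euc n)).symm : Euc n →L[ℝ] Euc n)‖₊ = 1 := by
        ext; exact ContinuousLinearMap.norm_id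
      rw [this, inv_one]
      exact_mod_cast (by norm_num : (1 / 2 : ℝ) < 1)
  refine ⟨happ.toHomeomorph Ψ hc, rfl, ?_⟩
  exact Homeomorph.contDiff_symm _
    (f₀' := fun a => (fderiv ℝ Ψ a).toContinuousLinearEquivOfDetNeZero (hdet a))
    (fun a => (hd a).hasFDerivAt) hΨ

lemma norm_sq_of_smul_add_inner_smul {m μ k : ℝ} {x v w : Euc n} (hm : m ≠ 0)
    (hk : k * (m + μ * ‖x‖ ^ 2) = m) (hv : v = m • w + (μ * ⟪x, w⟫) • x) :
    ‖w‖ ^ 2 = (m ^ 2)⁻¹ * (‖v‖ ^ 2 - (⟪x, v⟫ / ‖x‖) ^ 2 + k ^ 2 * (⟪x, v⟫ / ‖x‖) ^ 2) := by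
  have h1 : ⟪x, v⟫ = (m + μ * ‖x‖ ^ 2) * ⟪x, w⟫ := by
    rw [hv, inner_add_right, inner_smul_right, inner_smul_right, real_inner_self_eq_norm_sq]; ring
  have h2 : ‖v‖ ^ 2 = m ^ 2 * ‖w‖ ^ 2 + 2 * m * μ * ⟪x, w⟫ ^ 2 + μ ^ 2 * ⟪x, w⟫ ^ 2 * ‖x‖ ^ 2 := by
    rw [hv, norm_add_sq_real, norm_smul, norm_smul, inner_smul_left, inner_smul_right,
      mul_pow, mul_pow, Real.norm_eq_abs, Real.norm_eq_abs, sq_abs, sq_abs, real_inner_comm]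
    simp only [conj_trivial]
    ring
  rcases eq_or_ne x 0 with rfl | hx
  · simp only [inner_zero_left] at h1 h2 ⊢
    rw [h2]
    simp
    field_simp
  · have hx' : ‖x‖ ≠ 0 := norm_ne_zero_iff.2 hx
    have h3 : k * ⟪x, v⟫ = m * ⟪x, w⟫ := by rw [h1, ← mul_assoc, hk]
    have h4 : k ^ 2 * (⟪x, v⟫ / ‖x‖) ^ 2 = m ^ 2 * ⟪x, w⟫ ^ 2 / ‖x‖ ^ 2 := by
      rw [div_pow, ← mul_div_assoc, ← mul_pow, h3, mul_pow]
    rw [h4, h2, h1]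
    field_simp
    ring
end

section
variable {n : ℕ}

/-- `g` is a bounded `C¹` function with gradient `γ x • x`, supported in the ball of radius `R`. -/
structure IsRadialCutoff (g γ : Euc n → ℝ) (R M : ℝ) : Prop where
  hasFDerivAt : ∀ x, HasFDerivAt g (γ x • innerSL ℝ x) x
  continuous : Continuous γ
  abs_fun_le : ∀ x, |g x| ≤ M
  abs_slope_le : ∀ x, |γ x| ≤ M
  eq_zero : ∀ x, R < ‖x‖ → g x = 0
  eq_zero' : ∀ x, R < ‖x‖ → γ x = 0
  radius_nonneg : 0 ≤ R

/-- The radial deformation `x ↦ (1 - n t g(x))^{1/n} x`, whose Jacobian is affine in `t`. -/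
def radialStretch (g : Euc n → ℝ) (t : ℝ) (x : Euc n) : Euc n :=
  (1 - n * t * g x) ^ ((n : ℝ)⁻¹) • x

/-- The Jacobian determinant of `radialStretch g t` when `∇g(x) = γ(x) x`. -/
def radialJacobian (g γ : Euc n → ℝ) (t : ℝ) (x : Euc n) : ℝ :=
  1 - t * (n * g x + γ x * ‖x‖ ^ 2)

lemma abs_rpow_sub_one_le {z q : ℝ} (hz : 0 < z) (hq₀ : 0 ≤ q) (hq₁ : q ≤ 1) :
    |z ^ q - 1| ≤ |z - 1| := by
  rcases le_total 1 z with h | h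
  · have h1 := Real.one_le_rpow h hq₀
    have h2 := Real.rpow_le_rpow_of_exponent_le h hq₁
    rw [Real.rpow_one] at h2
    rw [abs_of_nonneg (by linarith), abs_of_nonneg (by linarith)]; linarith
  · have h1 := Real.rpow_le_one hz.le h hq₀
    have h2 := Real.rpow_le_rpow_of_exponent_ge hz h hq₁
    rw [Real.rpow_one] at h2
    rw [abs_of_nonpos (by linarith), abs_of_nonpos (by linarith)]; linarith

lemma rpow_sub_one_le_two {z q : ℝ} (hz : 1 / 2 ≤ z) (hq₀ : 0 ≤ q) (hq₁ : q ≤ 1) :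
    z ^ (q - 1) ≤ 2 := by
  calc z ^ (q - 1) ≤ (1 / 2 : ℝ) ^ (q - 1) :=
        Real.rpow_le_rpow_of_nonpos (by norm_num) hz (by linarith)
    _ ≤ (1 / 2 : ℝ) ^ (-1 : ℝ) :=
        Real.rpow_le_rpow_of_exponent_ge (by norm_num) (by norm_num) (by linarith)
    _ = 2 := by rw [Real.rpow_neg_one]; norm_num

namespace IsRadialCutoff
variable {g γ : Euc n → ℝ} {R M t : ℝ}

lemma bound_nonneg (h : IsRadialCutoff g γ R M) : 0 ≤ M := (abs_nonneg _).trans (h.abs_fun_le 0)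

lemma contDiff (h : IsRadialCutoff g γ R M) : ContDiff ℝ 1 g := by
  refine contDiff_one_iff_fderiv.2 ⟨fun x => (h.hasFDerivAt x).differentiableAt, ?_⟩
  have : fderiv ℝ g = fun x => γ x • innerSL ℝ x := funext fun x => (h.hasFDerivAt x).fderiv
  rw [this]
  exact h.continuous.smul (innerSL ℝ).continuous

lemma abs_mul_norm_sq_le (h : IsRadialCutoff g γ R M) (x : Euc n) :
    |γ x| * ‖x‖ ^ 2 ≤ M * R ^ 2 := by
  rcases lt_or_ge R ‖x‖ with hx | hx
  · rw [h.eq_zero' x hx, abs_zero, zero_mul]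
    exact mul_nonneg h.bound_nonneg (sq_nonneg _)
  · exact mul_le_mul (h.abs_slope_le x) (pow_le_pow_left₀ (norm_nonneg _) hx 2) (by positivity)
      h.bound_nonneg

lemma abs_scale_sub_one_le (h : IsRadialCutoff g γ R M) (t : ℝ) (x : Euc n) :
    |n * t * g x| ≤ |t| * (n * M) := by
  rw [abs_mul, abs_mul, Nat.abs_cast]
  nlinarith [mul_le_mul_of_nonneg_left (h.abs_fun_le x) (by positivity : 0 ≤ (n : ℝ) * |t|)]

lemma half_le_scale (h : IsRadialCutoff g γ R M) (ht : |t| * (n * M + 2 * M * R ^ 2) ≤ 1 / 2)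
    (x : Euc n) : 1 / 2 ≤ 1 - n * t * g x := by
  have h1 := (abs_le.1 (h.abs_scale_sub_one_le t x)).2
  have : 0 ≤ |t| * (2 * M * R ^ 2) := by have := h.bound_nonneg; positivity
  linarith

lemma half_le_radialJacobian (h : IsRadialCutoff g γ R M)
    (ht : |t| * (n * M + 2 * M * R ^ 2) ≤ 1 / 2) (x : Euc n) : 1 / 2 ≤ radialJacobian g γ t x := by
  have h1 := (abs_le.1 (h.abs_scale_sub_one_le t x)).2
  have h2 : |t * (γ x * ‖x‖ ^ 2)| ≤ |t| * (M * R ^ 2) := by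
    rw [abs_mul, abs_mul, abs_of_nonneg (sq_nonneg ‖x‖)]
    exact mul_le_mul_of_nonneg_left (h.abs_mul_norm_sq_le x) (abs_nonneg _)
  have h3 := (abs_le.1 h2).2
  have : 0 ≤ |t| * (M * R ^ 2) := by have := h.bound_nonneg; positivity
  unfold radialJacobian
  linarith

lemma inv_dim_le_one : (n : ℝ)⁻¹ ≤ 1 := Nat.cast_inv_le_one n

lemma abs_rpow_scale_sub_one_le (h : IsRadialCutoff g γ R M)
    (ht : |t| * (n * M + 2 * M * R ^ 2) ≤ 1 / 2) (x : Euc n) :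
    |(1 - n * t * g x) ^ ((n : ℝ)⁻¹) - 1| ≤ |t| * (n * M) := by
  refine (abs_rpow_sub_one_le (by linarith [h.half_le_scale ht x]) (by positivity)
    inv_dim_le_one).trans ?_
  rw [sub_sub_cancel_left, abs_neg]
  exact h.abs_scale_sub_one_le t x

lemma hasFDerivAt_radialStretch [NeZero n] (h : IsRadialCutoff g γ R M)
    (ht : |t| * (n * M + 2 * M * R ^ 2) ≤ 1 / 2) (x : Euc n) :
    HasFDerivAt (radialStretch g t)
      ((1 - n * t * g x) ^ ((n : ℝ)⁻¹) • ContinuousLinearMap.id ℝ (Euc n)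
        + (-(t * γ x * (1 - n * t * g x) ^ ((n : ℝ)⁻¹ - 1))) • (innerSL ℝ x).smulRight x) x := by
  have hn : (n : ℝ) ≠ 0 := NeZero.ne _
  have h1 : HasFDerivAt (fun x => 1 - n * t * g x) (-((n * t) • (γ x • innerSL ℝ x))) x :=
    ((h.hasFDerivAt x).const_mul (n * t)).const_sub 1
  have h2 := h1.rpow_const (p := (n : ℝ)⁻¹) (Or.inl (by linarith [h.half_le_scale ht x]))
  refine (h2.smul (hasFDerivAt_id x)).congr_fderiv ?_
  ext1 y
  simp only [_root_.add_apply, _root_.smul_apply, ContinuousLinearMap.smulRight_apply,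
    innerSL_apply_apply, smul_smul, smul_eq_mul, ContinuousLinearMap.id_apply, id,
    _root_.neg_apply]
  congr 2
  field_simp

lemma contDiff_radialStretch (h : IsRadialCutoff g γ R M)
    (ht : |t| * (n * M + 2 * M * R ^ 2) ≤ 1 / 2) : ContDiff ℝ 1 (radialStretch g t) := by
  refine ContDiff.smul (ContDiff.rpow_const_of_ne (contDiff_const.sub
    (contDiff_const.mul h.contDiff)) fun x => ?_) contDiff_id
  linarith [h.half_le_scale ht x]

lemma abs_shear_mul_norm_sq_le (h : IsRadialCutoff g γ R M)
    (ht : |t| * (n * M + 2 * M * R ^ 2) ≤ 1 / 2) (x : Euc n) :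
    |-(t * γ x * (1 - n * t * g x) ^ ((n : ℝ)⁻¹ - 1))| * ‖x‖ ^ 2 ≤ |t| * (2 * M * R ^ 2) := by
  have h1 := h.half_le_scale ht x
  have h2 := rpow_sub_one_le_two h1 (by positivity : 0 ≤ (n : ℝ)⁻¹) inv_dim_le_one
  have h3 := h.abs_mul_norm_sq_le x
  have h5 := h.bound_nonneg
  have h4 : 0 ≤ (1 - n * t * g x) ^ ((n : ℝ)⁻¹ - 1) := Real.rpow_nonneg (by linarith) _
  rw [abs_neg, abs_mul, abs_mul, abs_of_nonneg h4]
  calc |t| * |γ x| * (1 - n * t * g x) ^ ((n : ℝ)⁻¹ - 1) * ‖x‖ ^ 2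
      = |t| * ((|γ x| * ‖x‖ ^ 2) * (1 - n * t * g x) ^ ((n : ℝ)⁻¹ - 1)) := by ring
    _ ≤ |t| * ((M * R ^ 2) * 2) := by gcongr
    _ = _ := by ring

lemma norm_sub_scale_add_shear_le (h : IsRadialCutoff g γ R M)
    (ht : |t| * (n * M + 2 * M * R ^ 2) ≤ 1 / 2) (x y : Euc n) :
    ‖((1 - n * t * g x) ^ ((n : ℝ)⁻¹) • y
        + (-(t * γ x * (1 - n * t * g x) ^ ((n : ℝ)⁻¹ - 1)) * ⟪x, y⟫) • x) - y‖
      ≤ |t| * (n * M + 2 * M * R ^ 2) * ‖y‖ := by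
  have h1 := h.abs_rpow_scale_sub_one_le ht x
  have h2 := h.abs_shear_mul_norm_sq_le ht x
  set m := (1 - n * t * g x) ^ ((n : ℝ)⁻¹)
  set μ := -(t * γ x * (1 - n * t * g x) ^ ((n : ℝ)⁻¹ - 1))
  have e : m • y + (μ * ⟪x, y⟫) • x - y = (m - 1) • y + (μ * ⟪x, y⟫) • x := by module
  rw [e]
  calc _ ≤ ‖(m - 1) • y‖ + ‖(μ * ⟪x, y⟫) • x‖ := norm_add_le _ _
    _ = |m - 1| * ‖y‖ + |μ| * |⟪x, y⟫| * ‖x‖ := by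
        rw [norm_smul, norm_smul, Real.norm_eq_abs, Real.norm_eq_abs, abs_mul]
    _ ≤ |m - 1| * ‖y‖ + |μ| * (‖x‖ * ‖y‖) * ‖x‖ := by gcongr; exact abs_real_inner_le_norm x y
    _ = (|m - 1| + |μ| * ‖x‖ ^ 2) * ‖y‖ := by ring
    _ ≤ (|t| * (n * M) + |t| * (2 * M * R ^ 2)) * ‖y‖ := by gcongr
    _ = _ := by ring

lemma scale_add_shear_mul_norm_sq (h : IsRadialCutoff g γ R M)
    (ht : |t| * (n * M + 2 * M * R ^ 2) ≤ 1 / 2) (x : Euc n) :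
    (1 - n * t * g x) ^ ((n : ℝ)⁻¹)
        + (-(t * γ x * (1 - n * t * g x) ^ ((n : ℝ)⁻¹ - 1))) * ‖x‖ ^ 2
      = (1 - n * t * g x) ^ ((n : ℝ)⁻¹) * (radialJacobian g γ t x / (1 - n * t * g x)) := by
  have h1 := h.half_le_scale ht x
  rw [Real.rpow_sub_one (by linarith), radialJacobian]
  field_simp
  ring

lemma det_fderiv_radialStretch [NeZero n] (h : IsRadialCutoff g γ R M)
    (ht : |t| * (n * M + 2 * M * R ^ 2) ≤ 1 / 2) (x : Euc n) :
    (fderiv ℝ (radialStretch g t) x).det = radialJacobian g γ t x := by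
  have h1 := h.half_le_scale ht x
  have h0 : 0 < 1 - n * t * g x := by linarith
  rw [(h.hasFDerivAt_radialStretch ht x).fderiv,
    det_smul_id_add_smulRight (Real.rpow_pos_of_pos h0 _).ne',
    h.scale_add_shear_mul_norm_sq ht, ← mul_assoc, ← pow_succ,
    Nat.sub_add_cancel (Nat.one_le_iff_ne_zero.2 (NeZero.ne n)),
    Real.rpow_inv_natCast_pow h0.le (NeZero.ne n)]
  field_simp

lemma exists_homeomorph [NeZero n] (h : IsRadialCutoff g γ R M)
    (ht : |t| * (n * M + 2 * M * R ^ 2) ≤ 1 / 2) :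
    ∃ e : Euc n ≃ₜ Euc n, ⇑e = radialStretch g t ∧ ContDiff ℝ 1 e.symm := by
  refine exists_homeomorph_of_norm_fderiv_sub_id_le (h.contDiff_radialStretch ht) (fun x => ?_)
    fun x => ?_
  · rw [(h.hasFDerivAt_radialStretch ht x).fderiv]
    refine ContinuousLinearMap.opNorm_le_bound _ (by norm_num) fun y => ?_
    have := h.norm_sub_scale_add_shear_le ht x y
    simp only [_root_.add_apply, _root_.smul_apply, _root_.sub_apply,
      ContinuousLinearMap.smulRight_apply,
      innerSL_apply_apply, smul_smul, ContinuousLinearMap.id_apply]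
    exact this.trans (by gcongr)
  · rw [h.det_fderiv_radialStretch ht]
    linarith [h.half_le_radialJacobian ht x]

lemma integral_eq [NeZero n] (h : IsRadialCutoff g γ R M)
    (ht : |t| * (n * M + 2 * M * R ^ 2) ≤ 1 / 2) (G : Euc n → ℝ) :
    ∫ y, G y = ∫ x, radialJacobian g γ t x * G (radialStretch g t x) := by
  obtain ⟨e, he, -⟩ := h.exists_homeomorph ht
  have := integral_image_eq_integral_abs_det_fderiv_smul volume MeasurableSet.univ
    (fun x _ => (h.hasFDerivAt_radialStretch ht x).differentiableAt.hasFDerivAt.hasFDerivWithinAt)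
    (he ▸ e.injective.injOn) G
  rw [image_univ, ← he, e.range_coe, setIntegral_univ, setIntegral_univ, he] at this
  rw [this]
  refine integral_congr_ae (Eventually.of_forall fun x => ?_)
  simp only [h.det_fderiv_radialStretch ht, smul_eq_mul]
  rw [abs_of_nonneg (by linarith [h.half_le_radialJacobian ht x])]

lemma norm_radialStretch_sub_le (h : IsRadialCutoff g γ R M)
    (ht : |t| * (n * M + 2 * M * R ^ 2) ≤ 1 / 2) (x : Euc n) :
    ‖radialStretch g t x - x‖ ≤ |t| * (n * M * R) := by
  have h1 := h.abs_rpow_scale_sub_one_le ht x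
  rcases lt_or_ge R ‖x‖ with hx | hx
  · simp only [radialStretch, h.eq_zero x hx, mul_zero, sub_zero, Real.one_rpow, one_smul, sub_self,
      norm_zero]
    have := h.bound_nonneg
    have := h.radius_nonneg
    positivity
  · have : radialStretch g t x - x = ((1 - n * t * g x) ^ ((n : ℝ)⁻¹) - 1) • x := by
      rw [radialStretch]; module
    rw [this, norm_smul, Real.norm_eq_abs]
    calc _ ≤ |t| * (n * M) * R := mul_le_mul h1 hx (norm_nonneg _) (by
            have := h.bound_nonneg; positivity)
      _ = _ := by ring

end IsRadialCutoff
end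

section
variable {n : ℕ}

/-- The function `u ∘ (radialStretch g t)⁻¹`. -/
def radialPullback (g u : Euc n → ℝ) (t : ℝ) (y : Euc n) : ℝ :=
  u (Function.invFun (radialStretch g t) y)

/-- The factor by which `‖∇u‖ ^ p dx` is multiplied under a radial stretch, in terms of the values
`G = g`, `S = x · ∇g` and `κ = u_r² / |∇u|²`. -/
def stretchDensity (n : ℕ) (p G S κ t : ℝ) : ℝ :=
  (1 - n * t * G) ^ (-(p / n))
    * (1 - κ + κ * ((1 - n * t * G) / (1 - t * (n * G + S))) ^ 2) ^ (p / 2)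
    * (1 - t * (n * G + S))

namespace IsRadialCutoff
variable {g γ u : Euc n → ℝ} {R M t : ℝ}

lemma exists_radialPullback_eq [NeZero n] (h : IsRadialCutoff g γ R M)
    (ht : |t| * (n * M + 2 * M * R ^ 2) ≤ 1 / 2) (u : Euc n → ℝ) :
    ∃ e : Euc n ≃ₜ Euc n, ⇑e = radialStretch g t ∧ ContDiff ℝ 1 e.symm ∧
      radialPullback g u t = u ∘ e.symm := by
  obtain ⟨e, he, hc⟩ := h.exists_homeomorph ht
  refine ⟨e, he, hc, funext fun y => ?_⟩
  rw [radialPullback, ← he]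
  have : Function.invFun e y = e.symm y := by
    apply e.injective
    rw [e.apply_symm_apply, Function.invFun_eq (e.surjective y)]
  rw [this]; rfl

lemma contDiff_radialPullback [NeZero n] (h : IsRadialCutoff g γ R M)
    (ht : |t| * (n * M + 2 * M * R ^ 2) ≤ 1 / 2) (hu : ContDiff ℝ 1 u) :
    ContDiff ℝ 1 (radialPullback g u t) := by
  obtain ⟨e, -, hc, he⟩ := h.exists_radialPullback_eq ht u
  rw [he]
  exact hu.comp hc

lemma surjective_radialStretch [NeZero n] (h : IsRadialCutoff g γ R M)
    (ht : |t| * (n * M + 2 * M * R ^ 2) ≤ 1 / 2) : Function.Surjective (radialStretch g t) := by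
  obtain ⟨e, he, -⟩ := h.exists_homeomorph ht
  exact he ▸ e.surjective

lemma radialPullback_radialStretch [NeZero n] (h : IsRadialCutoff g γ R M)
    (ht : |t| * (n * M + 2 * M * R ^ 2) ≤ 1 / 2) (u : Euc n → ℝ) (x : Euc n) :
    radialPullback g u t (radialStretch g t x) = u x := by
  obtain ⟨e, he, -, hp⟩ := h.exists_radialPullback_eq ht u
  rw [hp, ← he, Function.comp_apply, e.symm_apply_apply]

lemma radialStretch_eq_self (h : IsRadialCutoff g γ R M) {x : Euc n} (hx : R < ‖x‖) :
    radialStretch g t x = x := by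
  rw [radialStretch, h.eq_zero x hx, mul_zero, sub_zero, Real.one_rpow, one_smul]

lemma radialPullback_eq_self [NeZero n] (h : IsRadialCutoff g γ R M)
    (ht : |t| * (n * M + 2 * M * R ^ 2) ≤ 1 / 2) (u : Euc n → ℝ) {x : Euc n} (hx : R < ‖x‖) :
    radialPullback g u t x = u x := by
  conv_lhs => rw [← h.radialStretch_eq_self (t := t) hx]
  exact h.radialPullback_radialStretch ht u x

lemma gradient_eq [NeZero n] (h : IsRadialCutoff g γ R M)
    (ht : |t| * (n * M + 2 * M * R ^ 2) ≤ 1 / 2) (hu : ContDiff ℝ 1 u) (x : Euc n) :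
    gradient u x = (1 - n * t * g x) ^ ((n : ℝ)⁻¹) •
        gradient (radialPullback g u t) (radialStretch g t x)
      + (-(t * γ x * (1 - n * t * g x) ^ ((n : ℝ)⁻¹ - 1))
        * ⟪x, gradient (radialPullback g u t) (radialStretch g t x)⟫) • x := by
  have hU := (h.contDiff_radialPullback ht hu).differentiable one_ne_zero (radialStretch g t x)
  have h1 := hU.hasGradientAt.hasFDerivAt.comp x (h.hasFDerivAt_radialStretch ht x)
  have h2 : radialPullback g u t ∘ radialStretch g t = u :=
    funext fun x => h.radialPullback_radialStretch ht u x
  rw [h2] at h1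
  refine ext_inner_right ℝ fun y => ?_
  have h3 := congrArg (fun L => L y)
    ((hu.differentiable one_ne_zero x).hasGradientAt.hasFDerivAt.unique h1)
  simp only [InnerProductSpace.toDual_apply_apply, ContinuousLinearMap.comp_apply, _root_.add_apply,
    _root_.smul_apply, ContinuousLinearMap.smulRight_apply, innerSL_apply_apply,
    ContinuousLinearMap.id_apply, inner_add_right, inner_smul_right] at h3
  rw [h3, inner_add_left, inner_smul_left, inner_smul_left,
    real_inner_comm x (gradient (radialPullback g u t) _)]
  simp only [conj_trivial]
  ring

lemma norm_gradient_radialPullback_sub_le [NeZero n] (h : IsRadialCutoff g γ R M)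
    (ht : |t| * (n * M + 2 * M * R ^ 2) ≤ 1 / 2) (hu : ContDiff ℝ 1 u) (x : Euc n) :
    ‖gradient (radialPullback g u t) (radialStretch g t x) - gradient u x‖
      ≤ |t| * (2 * (n * M + 2 * M * R ^ 2)) * ‖gradient u x‖ := by
  have h1 := h.norm_sub_scale_add_shear_le ht x
    (gradient (radialPullback g u t) (radialStretch g t x))
  rw [← h.gradient_eq ht hu x, norm_sub_rev] at h1
  set w := gradient (radialPullback g u t) (radialStretch g t x)
  have h2 : ‖w‖ ≤ 2 * ‖gradient u x‖ := by
    have := norm_sub_norm_le w (gradient u x)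
    nlinarith [norm_nonneg w]
  have h3 : 0 ≤ |t| * (n * M + 2 * M * R ^ 2) := by have := h.bound_nonneg; positivity
  nlinarith

lemma radialJacobian_mul_norm_rpow [NeZero n] (h : IsRadialCutoff g γ R M)
    (ht : |t| * (n * M + 2 * M * R ^ 2) ≤ 1 / 2) (hu : ContDiff ℝ 1 u) {p : ℝ} (hp : 1 < p)
    (x : Euc n) :
    radialJacobian g γ t x * ‖gradient (radialPullback g u t) (radialStretch g t x)‖ ^ p
      = ‖gradient u x‖ ^ p * stretchDensity n p (g x) (γ x * ‖x‖ ^ 2)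
          ((radialDeriv u x / ‖gradient u x‖) ^ 2) t := by
  have hτ : 0 < 1 - n * t * g x := by linarith [h.half_le_scale ht x]
  have hJ : 0 < radialJacobian g γ t x := by linarith [h.half_le_radialJacobian ht x]
  have hn : (n : ℝ) ≠ 0 := NeZero.ne _
  rcases eq_or_ne (gradient u x) 0 with h0 | h0
  · have := h.norm_gradient_radialPullback_sub_le ht hu x
    rw [h0, norm_zero, mul_zero, sub_zero] at this
    rw [le_antisymm this (norm_nonneg _), h0, norm_zero, Real.zero_rpow (by linarith), mul_zero,
      zero_mul]
  have hA : 0 < ‖gradient u x‖ := norm_pos_iff.2 h0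
  have hm : 0 < (1 - n * t * g x) ^ ((n : ℝ)⁻¹) := Real.rpow_pos_of_pos hτ _
  have key := norm_sq_of_smul_add_inner_smul (k := (1 - n * t * g x) / radialJacobian g γ t x)
    hm.ne' (by rw [h.scale_add_shear_mul_norm_sq ht]; field_simp) (h.gradient_eq ht hu x)
  set w := gradient (radialPullback g u t) (radialStretch g t x)
  set k := (1 - n * t * g x) / radialJacobian g γ t x
  set b := radialDeriv u x / ‖gradient u x‖
  have hb : b ^ 2 ≤ 1 := by
    have : |radialDeriv u x| ≤ ‖gradient u x‖ := by
      rw [radialDeriv, abs_div, abs_norm]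
      exact div_le_of_le_mul₀ (norm_nonneg _) (norm_nonneg _)
        ((abs_real_inner_le_norm _ _).trans_eq (mul_comm _ _))
    rw [sq_le_one_iff_abs_le_one, abs_div, abs_norm]
    exact (div_le_one hA).2 this
  have e1 : ⟪x, gradient u x⟫ / ‖x‖ = b * ‖gradient u x‖ := by
    simp only [b, radialDeriv]; field_simp
  have e2 : ‖w‖ ^ 2 = (((1 - n * t * g x) ^ ((n : ℝ)⁻¹)) ^ 2)⁻¹ *
      ((1 - b ^ 2 + b ^ 2 * k ^ 2) * ‖gradient u x‖ ^ 2) := by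
    rw [key, e1]; ring
  have hq : 0 ≤ 1 - b ^ 2 + b ^ 2 * k ^ 2 := by have := sq_nonneg (b * k); nlinarith
  have e3 : ∀ z : ℝ, 0 ≤ z → (z ^ 2) ^ (p / 2) = z ^ p := fun z hz => by
    rw [← Real.rpow_natCast, ← Real.rpow_mul hz]; congr 1; push_cast; ring
  have e4 : ‖w‖ ^ p = (1 - n * t * g x) ^ (-(p / n)) *
      ((1 - b ^ 2 + b ^ 2 * k ^ 2) ^ (p / 2) * ‖gradient u x‖ ^ p) := by
    rw [← e3 _ (norm_nonneg w), e2, Real.mul_rpow (by positivity) (by positivity),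
      Real.mul_rpow hq (by positivity), e3 _ (norm_nonneg _), Real.inv_rpow (by positivity),
      e3 _ hm.le, ← Real.rpow_mul hτ.le, ← Real.rpow_neg hτ.le]
    congr 2; ring
  rw [e4, stretchDensity]
  simp only [k, radialJacobian]
  ring

end IsRadialCutoff

lemma eventually_abs_mul_le {δ : ℝ} (hδ : 0 < δ) (B : ℝ) :
    ∀ᶠ t in nhdsWithin (0 : ℝ) {0}ᶜ, |t| * B ≤ δ := by
  have : Tendsto (fun t : ℝ => |t| * B) (nhds 0) (nhds (|(0 : ℝ)| * B)) :=
    (continuous_abs.mul continuous_const).tendsto 0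
  rw [abs_zero, zero_mul] at this
  exact nhdsWithin_le_nhds ((this.eventually_lt_const hδ).mono fun t ht => ht.le)

end

section
variable {n : ℕ} {g γ u : Euc n → ℝ} {f : ℝ → ℝ} {R M p : ℝ}

lemma eventually_neg_nhdsNE {P : ℝ → Prop} (h : ∀ᶠ t in nhdsWithin (0 : ℝ) {0}ᶜ, P t) :
    ∀ᶠ t in nhdsWithin (0 : ℝ) {0}ᶜ, P (-t) := by
  have : Tendsto (fun t : ℝ => -t) (nhdsWithin 0 {0}ᶜ) (nhdsWithin 0 {0}ᶜ) := by
    refine tendsto_nhdsWithin_iff.2 ⟨?_, ?_⟩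
    · have := (continuous_neg (G := ℝ)).tendsto 0
      rw [neg_zero] at this
      exact this.mono_left nhdsWithin_le_nhds
    · filter_upwards [self_mem_nhdsWithin] with t ht
      simpa using ht
  exact this.eventually h

lemma IsRadialCutoff.eventually_abs_radialPullback_sub_le [NeZero n] (h : IsRadialCutoff g γ R M)
    (hu : ContDiff ℝ 1 u) (huc : HasCompactSupport u) {η : ℝ} (hη : 0 < η) :
    ∀ᶠ t in nhdsWithin 0 {0}ᶜ, ∀ x, |radialPullback g u t x - u x| ≤
      |t| * ((n * M * R + 1) * ‖gradient u x‖ + η) := by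
  have hM := h.bound_nonneg
  have hR := h.radius_nonneg
  set D := n * M * R with hD
  have hD0 : 0 ≤ D := by positivity
  have huC : UniformContinuous (gradient u) :=
    huc.gradient.uniformContinuous_of_continuous hu.continuous_gradient
  obtain ⟨δ, hδ, H⟩ := Metric.uniformContinuous_iff_le.1 huC (η / (D + 1)) (by positivity)
  filter_upwards [eventually_abs_mul_le (by norm_num : (0 : ℝ) < 1 / 2)
    (n * M + 2 * M * R ^ 2), eventually_abs_mul_le hδ D] with t ht htδ y
  obtain ⟨x, rfl⟩ := h.surjective_radialStretch ht y
  rw [h.radialPullback_radialStretch ht]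
  have hd := h.norm_radialStretch_sub_le ht x
  rw [norm_sub_rev] at hd
  set y := radialStretch g t x
  have key := (convex_closedBall y (|t| * D)).norm_image_sub_le_of_norm_hasFDerivWithin_le
    (f := u) (f' := fun z => InnerProductSpace.toDual ℝ _ (gradient u z))
    (C := ‖gradient u y‖ + η / (D + 1)) (x := y) (y := x)
    (fun z _ => (hu.differentiable one_ne_zero z).hasGradientAt.hasFDerivAt.hasFDerivWithinAt)
    (fun z hz => by
      have h1 := H (mem_closedBall.1 hz |>.trans htδ)
      rw [dist_eq_norm] at h1
      rw [LinearIsometryEquiv.norm_map]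
      linarith [norm_sub_norm_le (gradient u z) (gradient u y)])
    (mem_closedBall_self (by positivity)) (by rwa [mem_closedBall, dist_eq_norm])
  rw [Real.norm_eq_abs] at key
  refine key.trans ?_
  calc (‖gradient u y‖ + η / (D + 1)) * ‖x - y‖ ≤ (‖gradient u y‖ + η / (D + 1)) * (|t| * D) := by
        gcongr
    _ = |t| * (D * ‖gradient u y‖ + D / (D + 1) * η) := by ring
    _ ≤ |t| * ((D + 1) * ‖gradient u y‖ + 1 * η) := by
        gcongr
        · linarith
        · exact (div_le_one (by positivity)).2 (by linarith)
    _ = _ := by rw [one_mul]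

lemma IsRadialCutoff.eventually_norm_gradient_radialPullback_sub_le [NeZero n]
    (h : IsRadialCutoff g γ R M) (hu : ContDiff ℝ 1 u) (huc : HasCompactSupport u)
    {η : ℝ} (hη : 0 < η) :
    ∀ᶠ t in nhdsWithin 0 {0}ᶜ, ∀ x, ‖gradient (radialPullback g u t) x - gradient u x‖ ≤ η := by
  have hM := h.bound_nonneg
  have huC : UniformContinuous (gradient u) :=
    huc.gradient.uniformContinuous_of_continuous hu.continuous_gradient
  obtain ⟨δ, hδ, H⟩ := Metric.uniformContinuous_iff_le.1 huC (η / 2) (by positivity)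
  obtain ⟨V, hV⟩ := hu.continuous_gradient.bounded_above_of_compact_support huc.gradient
  filter_upwards [eventually_abs_mul_le (by norm_num : (0 : ℝ) < 1 / 2)
    (n * M + 2 * M * R ^ 2), eventually_abs_mul_le hδ (n * M * R),
    eventually_abs_mul_le (half_pos hη) (2 * (n * M + 2 * M * R ^ 2) * V)] with t ht htδ htη y
  obtain ⟨x, rfl⟩ := h.surjective_radialStretch ht y
  have h1 := h.norm_gradient_radialPullback_sub_le ht hu x
  have h2 := H (a := x) (b := radialStretch g t x)
    (by rw [dist_comm, dist_eq_norm]; exact (h.norm_radialStretch_sub_le ht x).trans htδ)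
  rw [dist_eq_norm] at h2
  have h3 : |t| * (2 * (n * M + 2 * M * R ^ 2)) * ‖gradient u x‖ ≤ η / 2 := by
    refine le_trans (mul_le_mul_of_nonneg_left (hV x) (by positivity)) ?_
    rwa [mul_assoc]
  have h4 := norm_sub_le_norm_sub_add_norm_sub
    (gradient (radialPullback g u t) (radialStretch g t x)) (gradient u x)
    (gradient u (radialStretch g t x))
  linarith

lemma IsRadialCutoff.hasCompactSupport_radialPullback [NeZero n] (h : IsRadialCutoff g γ R M)
    {t : ℝ} (ht : |t| * (n * M + 2 * M * R ^ 2) ≤ 1 / 2) (huc : HasCompactSupport u) :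
    HasCompactSupport (radialPullback g u t) := by
  refine HasCompactSupport.of_support_subset_isCompact
    (huc.isCompact.union (isCompact_closedBall (0 : Euc n) R)) fun x hx => ?_
  by_contra hc
  rw [mem_union, not_or, mem_closedBall_zero_iff, not_le] at hc
  exact hx ((h.radialPullback_eq_self ht u hc.2).trans (image_eq_zero_of_notMem_tsupport hc.1))

lemma IsRadialCutoff.continuous_radialJacobian (h : IsRadialCutoff g γ R M) (t : ℝ) :
    Continuous (radialJacobian g γ t) := by
  have := h.contDiff.continuous
  have := h.continuous
  unfold radialJacobian
  fun_prop

lemma integrable_norm_gradient_rpow (hp : 1 < p) (hu : ContDiff ℝ 1 u)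
    (huc : HasCompactSupport u) : Integrable (fun x => ‖gradient u x‖ ^ p) := by
  refine (hu.continuous_gradient.norm.rpow_const fun _ => Or.inr (by linarith)).integrable_of_hasCompactSupport ?_
  exact huc.gradient.comp_left (g := fun v => ‖v‖ ^ p)
    (by rw [norm_zero, Real.zero_rpow (by linarith)])

lemma integrable_primitive_comp (hf : Continuous f) (hu : ContDiff ℝ 1 u)
    (huc : HasCompactSupport u) : Integrable (fun x => ∫ s in (0 : ℝ)..u x, f s) := by
  have hF : Continuous fun b : ℝ => ∫ s in (0 : ℝ)..b, f s :=
    intervalIntegral.continuous_primitive (fun _ _ => hf.intervalIntegrable _ _) 0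
  exact (hF.comp hu.continuous).integrable_of_hasCompactSupport
    (huc.comp_left (g := fun b : ℝ => ∫ s in (0 : ℝ)..b, f s) intervalIntegral.integral_same)

lemma IsRadialCutoff.integrable_norm_rpow_mul_stretchDensity [NeZero n]
    (h : IsRadialCutoff g γ R M) {t : ℝ} (ht : |t| * (n * M + 2 * M * R ^ 2) ≤ 1 / 2)
    (hp : 1 < p) (hu : ContDiff ℝ 1 u) (huc : HasCompactSupport u) :
    Integrable fun x => ‖gradient u x‖ ^ p * stretchDensity n p (g x) (γ x * ‖x‖ ^ 2)
      ((radialDeriv u x / ‖gradient u x‖) ^ 2) t := by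
  simp only [← h.radialJacobian_mul_norm_rpow ht hu hp]
  obtain ⟨e, he, -⟩ := h.exists_homeomorph ht
  have hU := h.contDiff_radialPullback ht hu
  have hUc := h.hasCompactSupport_radialPullback ht huc
  refine Continuous.integrable_of_hasCompactSupport ((h.continuous_radialJacobian t).mul
    ((hU.continuous_gradient.comp (h.contDiff_radialStretch ht).continuous).norm.rpow_const
      fun _ => Or.inr (by linarith))) ?_
  refine HasCompactSupport.mul_left ?_
  have : HasCompactSupport (fun y => ‖gradient (radialPullback g u t) y‖ ^ p) :=
    hUc.gradient.comp_left (g := fun v => ‖v‖ ^ p)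
      (by rw [norm_zero, Real.zero_rpow (by linarith)])
  rw [← he]
  exact this.comp_homeomorph e

theorem IsRadialCutoff.eventually_neg_mul_sq_le_integral [NeZero n] (h : IsRadialCutoff g γ R M)
    (hp : 1 < p) (hf : ContDiff ℝ 1 f) (hu : ContDiff ℝ 1 u) (huc : HasCompactSupport u)
    (weak : ∀ ξ, ContDiff ℝ 1 ξ → tsupport ξ ⊆ closedBall (0 : Euc n) R →
      ∫ x, ‖gradient u x‖ ^ (p - 2) * ⟪gradient u x, gradient ξ x⟫ = ∫ x, f (u x) * ξ x)
    (stab : ∀ ξ, ContDiff ℝ 1 ξ → tsupport ξ ⊆ closedBall (0 : Euc n) R →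
      ∫ x, deriv f (u x) * ξ x ^ 2 ≤ ∫ x in {y | 0 < ‖gradient u y‖},
        (‖gradient u x‖ ^ (p - 2) * ‖gradient ξ x‖ ^ 2
          + (p - 2) * ‖gradient u x‖ ^ (p - 4) * ⟪gradient u x, gradient ξ x⟫ ^ 2))
    {ε : ℝ} (hε : 0 < ε) :
    ∀ᶠ t in nhdsWithin (0 : ℝ) {0}ᶜ, -(ε * t ^ 2) ≤ ∫ x, ‖gradient u x‖ ^ p *
      (stretchDensity n p (g x) (γ x * ‖x‖ ^ 2) ((radialDeriv u x / ‖gradient u x‖) ^ 2) t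
      + stretchDensity n p (g x) (γ x * ‖x‖ ^ 2) ((radialDeriv u x / ‖gradient u x‖) ^ 2) (-t)
      - 2) := by
  have hM := h.bound_nonneg
  have hR := h.radius_nonneg
  have hsmall := eventually_abs_mul_le (by norm_num : (0 : ℝ) < 1 / 2) (n * M + 2 * M * R ^ 2)
  have key := eventually_neg_mul_sq_le_energy_sub hp hf hu huc (isCompact_closedBall 0 R) weak stab
    (U := radialPullback g u) (C := n * M * R + 1) (by positivity)
    (hsmall.mono fun t ht => ⟨h.contDiff_radialPullback ht hu, fun x hx => by
      rw [mem_closedBall_zero_iff, not_le] at hx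
      exact h.radialPullback_eq_self ht u hx⟩)
    (fun η hη => h.eventually_abs_radialPullback_sub_le hu huc hη)
    (fun η hη => h.eventually_norm_gradient_radialPullback_sub_le hu huc hη)
    (ε := ε / (2 * p)) (by positivity)
  have energy : ∀ t : ℝ, |t| * (n * M + 2 * M * R ^ 2) ≤ 1 / 2 →
      ∫ x, ((‖gradient (radialPullback g u t) x‖ ^ p - ‖gradient u x‖ ^ p) / p
        - ((∫ s in (0 : ℝ)..radialPullback g u t x, f s) - ∫ s in (0 : ℝ)..u x, f s))
      = ((∫ x, ‖gradient u x‖ ^ p * stretchDensity n p (g x) (γ x * ‖x‖ ^ 2)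
          ((radialDeriv u x / ‖gradient u x‖) ^ 2) t) - ∫ x, ‖gradient u x‖ ^ p) / p
        - ((∫ x, radialJacobian g γ t x * ∫ s in (0 : ℝ)..u x, f s)
          - ∫ x, ∫ s in (0 : ℝ)..u x, f s) := fun t ht => by
    have hU := h.contDiff_radialPullback ht hu
    have hUc := h.hasCompactSupport_radialPullback ht huc
    have i1 := integrable_norm_gradient_rpow hp hU hUc
    have i2 := integrable_norm_gradient_rpow hp hu huc
    have i3 := integrable_primitive_comp hf.continuous hU hUc
    have i4 := integrable_primitive_comp hf.continuous hu huc
    have i5 : Integrable fun x =>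
        (‖gradient (radialPullback g u t) x‖ ^ p - ‖gradient u x‖ ^ p) / p :=
      (i1.sub i2).div_const p
    have i6 : Integrable fun x =>
        (∫ s in (0 : ℝ)..radialPullback g u t x, f s) - ∫ s in (0 : ℝ)..u x, f s := i3.sub i4
    rw [integral_sub i5 i6, integral_div, integral_sub i1 i2,
      integral_sub i3 i4, h.integral_eq ht, h.integral_eq ht
        (fun x => ∫ s in (0 : ℝ)..radialPullback g u t x, f s)]
    simp only [h.radialJacobian_mul_norm_rpow ht hu hp, h.radialPullback_radialStretch ht]
  filter_upwards [hsmall, key, eventually_neg_nhdsNE key] with t ht k1 k2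
  have ht' : |-t| * (n * M + 2 * M * R ^ 2) ≤ 1 / 2 := by rwa [abs_neg]
  rw [energy t ht] at k1
  rw [energy (-t) ht'] at k2
  have i0 := integrable_norm_gradient_rpow hp hu huc
  have i1 := h.integrable_norm_rpow_mul_stretchDensity ht hp hu huc
  have i2 := h.integrable_norm_rpow_mul_stretchDensity ht' hp hu huc
  have i4 := integrable_primitive_comp hf.continuous hu huc
  have i5 : ∀ t, Integrable fun x => radialJacobian g γ t x * ∫ s in (0 : ℝ)..u x, f s := fun t => by
    have hF : Continuous fun b : ℝ => ∫ s in (0 : ℝ)..b, f s :=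
      intervalIntegral.continuous_primitive (fun _ _ => hf.continuous.intervalIntegrable _ _) 0
    refine ((h.continuous_radialJacobian t).mul
      (hF.comp hu.continuous)).integrable_of_hasCompactSupport (HasCompactSupport.mul_left ?_)
    exact huc.comp_left (g := fun b : ℝ => ∫ s in (0 : ℝ)..b, f s) intervalIntegral.integral_same
  have e1 : (∫ x, radialJacobian g γ t x * ∫ s in (0 : ℝ)..u x, f s)
      + (∫ x, radialJacobian g γ (-t) x * ∫ s in (0 : ℝ)..u x, f s)
      = 2 * ∫ x, ∫ s in (0 : ℝ)..u x, f s := by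
    rw [← integral_add (i5 t) (i5 (-t)), ← integral_const_mul]
    congr 1; ext x; unfold radialJacobian; ring
  have e2 : ∫ x, ‖gradient u x‖ ^ p *
      (stretchDensity n p (g x) (γ x * ‖x‖ ^ 2) ((radialDeriv u x / ‖gradient u x‖) ^ 2) t
      + stretchDensity n p (g x) (γ x * ‖x‖ ^ 2) ((radialDeriv u x / ‖gradient u x‖) ^ 2) (-t)
      - 2) = (∫ x, ‖gradient u x‖ ^ p * stretchDensity n p (g x) (γ x * ‖x‖ ^ 2)
          ((radialDeriv u x / ‖gradient u x‖) ^ 2) t)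
        + (∫ x, ‖gradient u x‖ ^ p * stretchDensity n p (g x) (γ x * ‖x‖ ^ 2)
          ((radialDeriv u x / ‖gradient u x‖) ^ 2) (-t)) - 2 * ∫ x, ‖gradient u x‖ ^ p := by
    rw [← integral_add i1 i2, ← integral_const_mul]
    refine Eq.trans ?_ (integral_sub (i1.add i2) (i0.const_mul 2))
    congr 1; ext x; ring
  rw [e2]
  have hp0 : 0 < p := by linarith
  set A := ∫ x, ‖gradient u x‖ ^ p * stretchDensity n p (g x) (γ x * ‖x‖ ^ 2)
          ((radialDeriv u x / ‖gradient u x‖) ^ 2) t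
  set B := ∫ x, ‖gradient u x‖ ^ p * stretchDensity n p (g x) (γ x * ‖x‖ ^ 2)
          ((radialDeriv u x / ‖gradient u x‖) ^ 2) (-t)
  set I := ∫ x, ‖gradient u x‖ ^ p
  have e3 : -(ε * t ^ 2) / p ≤ (A + B - 2 * I) / p := by
    have : (A + B - 2 * I) / p = (A - I) / p + (B - I) / p := by ring
    rw [this]
    have : -(ε * t ^ 2) / p = -(ε / (2 * p) * t ^ 2) + -(ε / (2 * p) * (-t) ^ 2) := by
      field_simp; ring
    rw [this]
    linarith
  exact (div_le_div_iff_of_pos_right hp0).1 e3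
end

lemma abs_sub_le_mul_sq_of_abs_deriv_le {h h' : ℝ → ℝ} {C δ : ℝ} (hC : 0 ≤ C)
    (hd : ∀ s, |s| ≤ δ → HasDerivAt h (h' s) s) (hb : ∀ s, |s| ≤ δ → |h' s| ≤ C * |s|)
    {t : ℝ} (ht : |t| ≤ δ) : |h t - h 0| ≤ C * t ^ 2 := by
  have key := (convex_closedBall (0 : ℝ) |t|).norm_image_sub_le_of_norm_hasDerivWithin_le
    (f := h) (f' := h') (C := C * |t|) (x := 0) (y := t)
    (fun s hs => (hd s ((mem_closedBall_zero_iff.1 hs).trans ht)).hasDerivWithinAt)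
    (fun s hs => (hb s ((mem_closedBall_zero_iff.1 hs).trans ht)).trans
      (mul_le_mul_of_nonneg_left (mem_closedBall_zero_iff.1 hs) hC))
    (mem_closedBall_self (abs_nonneg t)) (by simp)
  rw [sub_zero, Real.norm_eq_abs, Real.norm_eq_abs, mul_assoc, ← pow_two, sq_abs] at key
  exact key

lemma tendsto_second_difference {φ ψ : ℝ → ℝ} {d : ℝ}
    (hφ : ∀ᶠ t in nhds 0, HasDerivAt φ (ψ t) t) (hψ : HasDerivAt ψ d 0) :
    Tendsto (fun t => (φ t + φ (-t) - 2 * φ 0) / t ^ 2) (nhdsWithin 0 {0}ᶜ) (nhds d) := by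
  rw [Metric.tendsto_nhds]
  intro ε hε
  have h1 : ∀ᶠ t in nhds (0 : ℝ), |ψ t - ψ 0 - d * t| ≤ ε / 4 * |t| := by
    have := (hasDerivAt_iff_isLittleO.1 hψ).def (by positivity : 0 < ε / 4)
    simpa [mul_comm] using this
  obtain ⟨δ, hδ, H⟩ := Metric.eventually_nhds_iff_ball.1 (hφ.and h1)
  filter_upwards [self_mem_nhdsWithin, nhdsWithin_le_nhds (ball_mem_nhds (0 : ℝ) (half_pos hδ))]
    with t ht htδ
  rw [mem_ball_zero_iff, Real.norm_eq_abs] at htδ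
  have hs : ∀ s : ℝ, |s| ≤ δ / 2 → s ∈ ball (0 : ℝ) δ ∧ -s ∈ ball (0 : ℝ) δ := fun s hs => by
    rw [mem_ball_zero_iff, mem_ball_zero_iff, norm_neg, Real.norm_eq_abs]
    constructor <;> linarith
  have key := abs_sub_le_mul_sq_of_abs_deriv_le
    (h := fun t => φ t + φ (-t) - d * t ^ 2)
    (h' := fun s => ψ s - ψ (-s) - 2 * d * s) (C := ε / 2) (δ := δ / 2) (by positivity)
    (fun s h => by
      have e1 := (H s (hs s h).1).1
      have e2 := (H (-s) (hs s h).2).1.comp s (hasDerivAt_neg s)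
      refine ((e1.add e2).sub ((hasDerivAt_pow 2 s).const_mul d)).congr_deriv ?_
      simp only [Nat.add_one_sub_one, pow_one, Nat.cast_ofNat]
      ring)
    (fun s h => by
      have e1 := abs_le.1 (H s (hs s h).1).2
      have e2 := (H (-s) (hs s h).2).2
      rw [abs_neg] at e2
      have e2 := abs_le.1 e2
      rw [abs_le]
      constructor <;> linarith) htδ.le
  have ht2 : 0 < t ^ 2 := by have : t ≠ 0 := ht; positivity
  rw [Real.dist_eq, div_sub' ht2.ne', abs_div, abs_of_pos ht2, div_lt_iff₀ ht2]
  have e : φ t + φ (-t) - d * t ^ 2 - (φ 0 + φ (-0) - d * 0 ^ 2)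
      = φ t + φ (-t) - 2 * φ 0 - t ^ 2 * d := by rw [neg_zero]; ring
  rw [e] at key
  nlinarith

lemma exists_eventually_abs_second_difference_le {Z : Type*} [NormedAddCommGroup Z]
    [NormedSpace ℝ Z] {F : ℝ × Z → ℝ} {S : Set Z} (hS : IsCompact S)
    (hF : ∀ z ∈ S, ContDiffAt ℝ 2 F (0, z)) :
    ∃ C, 0 ≤ C ∧ ∀ᶠ t in nhds (0 : ℝ), ∀ z ∈ S,
      |F (t, z) + F (-t, z) - 2 * F (0, z)| ≤ C * t ^ 2 := by
  refine hS.induction_on (p := fun S => ∃ C, 0 ≤ C ∧ ∀ᶠ t in nhds (0 : ℝ), ∀ z ∈ S,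
      |F (t, z) + F (-t, z) - 2 * F (0, z)| ≤ C * t ^ 2) ⟨0, le_rfl, by simp⟩ ?_ ?_ ?_
  · rintro s t hst ⟨C, hC, H⟩
    exact ⟨C, hC, H.mono fun _ h z hz => h z (hst hz)⟩
  · rintro s t ⟨C, hC, H⟩ ⟨D, hD, H'⟩
    refine ⟨max C D, le_max_of_le_left hC, ?_⟩
    filter_upwards [H, H'] with r h h' z hz
    rcases hz with hz | hz
    · exact (h z hz).trans (mul_le_mul_of_nonneg_right (le_max_left _ _) (sq_nonneg _))
    · exact (h' z hz).trans (mul_le_mul_of_nonneg_right (le_max_right _ _) (sq_nonneg _))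
  · intro z₀ hz₀
    obtain ⟨K, T, hT, hL⟩ := ((hF z₀ hz₀).fderiv_right (m := 1) (by norm_num)).exists_lipschitzOnWith
    have hD : ∀ᶠ w in nhds ((0 : ℝ), z₀), DifferentiableAt ℝ F w :=
      ((hF z₀ hz₀).eventually (by simp)).mono fun w hw => hw.differentiableAt (by norm_num)
    obtain ⟨T', hT', hT''⟩ := eventually_iff_exists_mem.1 hD
    have hmem := inter_mem hT hT'
    rw [nhds_prod_eq, mem_prod_iff] at hmem
    obtain ⟨A, hA, B, hB, hAB⟩ := hmem
    refine ⟨B, mem_nhdsWithin_of_mem_nhds hB, 2 * K, by positivity, ?_⟩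
    obtain ⟨δ, hδ, hδA⟩ := Metric.mem_nhds_iff.1 hA
    filter_upwards [ball_mem_nhds (0 : ℝ) (half_pos hδ)] with t ht z hz
    rw [mem_ball_zero_iff, Real.norm_eq_abs] at ht
    have hs : ∀ s : ℝ, |s| ≤ δ / 2 → (s, z) ∈ T ∩ T' ∧ (-s, z) ∈ T ∩ T' := fun s hs => by
      constructor
      · refine hAB ⟨hδA ?_, hz⟩
        rw [mem_ball_zero_iff, Real.norm_eq_abs]; linarith
      · refine hAB ⟨hδA ?_, hz⟩
        rw [mem_ball_zero_iff, norm_neg, Real.norm_eq_abs]; linarith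
    have key := abs_sub_le_mul_sq_of_abs_deriv_le
      (h := fun t => F (t, z) + F (-t, z))
      (h' := fun s => fderiv ℝ F (s, z) (1, 0) - fderiv ℝ F (-s, z) (1, 0)) (C := 2 * K)
      (δ := δ / 2) (by positivity)
      (fun s h => by
        have e0 : HasDerivAt (fun s : ℝ => (s, z)) ((1 : ℝ), (0 : Z)) s :=
          (hasDerivAt_id s).prodMk (hasDerivAt_const s z)
        have e0' : HasDerivAt (fun s : ℝ => (-s, z)) (-(1 : ℝ), (0 : Z)) s :=
          (hasDerivAt_neg s).prodMk (hasDerivAt_const s z)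
        have e1 := (hT'' _ (hs s h).1.2).hasFDerivAt.comp_hasDerivAt s e0
        have e2 := (hT'' _ (hs s h).2.2).hasFDerivAt.comp_hasDerivAt s e0'
        refine (e1.add e2).congr_deriv ?_
        have : (-(1 : ℝ), (0 : Z)) = -((1 : ℝ), (0 : Z)) := by simp
        rw [this, map_neg, sub_eq_add_neg])
      (fun s h => by
        have e1 := hL.dist_le_mul _ (hs s h).1.1 _ (hs s h).2.1
        rw [dist_eq_norm, dist_eq_norm] at e1
        have e2 : ((s, z) - (-s, z) : ℝ × Z) = (2 * s, 0) := by
          ext <;> simp; ring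
        have e3 : ‖((2 * s, 0) : ℝ × Z)‖ = 2 * |s| := by
          rw [Prod.norm_mk, norm_zero, Real.norm_eq_abs, abs_mul, abs_two]
          exact max_eq_left (by positivity)
        rw [e2, e3] at e1
        have e4 := (fderiv ℝ F (s, z) - fderiv ℝ F (-s, z)).le_opNorm ((1 : ℝ), (0 : Z))
        have e5 : ‖((1 : ℝ), (0 : Z))‖ = 1 := by
          rw [Prod.norm_mk, norm_zero, norm_one]; exact max_eq_left zero_le_one
        rw [e5, mul_one] at e4
        rw [← Real.norm_eq_abs]
        exact e4.trans (e1.trans_eq (by ring)))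
      ht.le
    simp only [neg_zero, ← two_mul] at key
    exact key

lemma contDiffAt_stretchDensity (n : ℕ) (p G S κ : ℝ) :
    ContDiffAt ℝ 2 (fun w : ℝ × ℝ × ℝ × ℝ => stretchDensity n p w.2.1 w.2.2.1 w.2.2.2 w.1)
      (0, G, S, κ) := by
  have h1 : ContDiffAt ℝ 2 (fun w : ℝ × ℝ × ℝ × ℝ => 1 - n * w.1 * w.2.1) (0, G, S, κ) := by
    fun_prop
  have h2 : ContDiffAt ℝ 2 (fun w : ℝ × ℝ × ℝ × ℝ => 1 - w.1 * (n * w.2.1 + w.2.2.1))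
      (0, G, S, κ) := by
    fun_prop
  have h3 : ContDiffAt ℝ 2 (fun w : ℝ × ℝ × ℝ × ℝ => 1 - w.2.2.2 + w.2.2.2 *
      ((1 - n * w.1 * w.2.1) / (1 - w.1 * (n * w.2.1 + w.2.2.1))) ^ 2) (0, G, S, κ) :=
    ContDiffAt.add (by fun_prop) (ContDiffAt.mul (by fun_prop) ((h1.div h2 (by simp)).pow 2))
  exact ((h1.rpow_const_of_ne (by simp)).mul (h3.rpow_const_of_ne (by simp))).mul h2

lemma stretchDensity_zero (n : ℕ) (p G S κ : ℝ) : stretchDensity n p G S κ 0 = 1 := by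
  simp [stretchDensity]

lemma tendsto_second_difference_stretchDensity {n : ℕ} [NeZero n] (p G S κ : ℝ) :
    Tendsto (fun t => (stretchDensity n p G S κ t + stretchDensity n p G S κ (-t) - 2) / t ^ 2)
      (nhdsWithin 0 {0}ᶜ)
      (nhds (p * ((p - n) * G ^ 2 + 2 * (p * κ - 1) * (G * S) + (κ + (p - 2) * κ ^ 2) * S ^ 2))) := by
  have hn : (n : ℝ) ≠ 0 := NeZero.ne _
  set τ : ℝ → ℝ := fun t => 1 - n * t * G with hτ
  set J : ℝ → ℝ := fun t => 1 - t * (n * G + S) with hJ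
  set q : ℝ → ℝ := fun t => 1 - κ + κ * (τ t / J t) ^ 2 with hq
  have dτ : ∀ t, HasDerivAt τ (-(n * G)) t := fun t => by
    have := (((hasDerivAt_id t).const_mul (n : ℝ)).mul_const G).const_sub 1
    simpa using this
  have dJ : ∀ t, HasDerivAt J (-(n * G + S)) t := fun t => by
    have := ((hasDerivAt_id t).mul_const (n * G + S)).const_sub 1
    simpa using this
  have dq : ∀ t, J t ≠ 0 → HasDerivAt q (2 * κ * S * (τ t / J t ^ 3)) t := fun t ht => by
    have := ((((dτ t).div (dJ t) ht).pow 2).const_mul κ).const_add (1 - κ)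
    refine this.congr_deriv ?_
    simp only [Pi.div_apply, Nat.cast_ofNat, Nat.add_one_sub_one, pow_one]
    simp only [hτ, hJ] at ht ⊢
    field_simp
    ring
  have τ0 : τ 0 = 1 := by simp [hτ]
  have J0 : J 0 = 1 := by simp [hJ]
  have q0 : q 0 = 1 := by simp [hq, τ0, J0]
  set L : ℝ → ℝ := fun t => p * G * (1 / τ t) + p * κ * S * (τ t / (J t ^ 3 * q t))
    - (n * G + S) * (1 / J t) with hL
  have dφ : ∀ t, 0 < τ t → 0 < J t → 0 < q t →
      HasDerivAt (stretchDensity n p G S κ) (stretchDensity n p G S κ t * L t) t :=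
    fun t h1 h2 h3 => by
    have := (((dτ t).rpow_const (p := -(p / n)) (Or.inl h1.ne')).mul
      ((dq t h2.ne').rpow_const (p := p / 2) (Or.inl h3.ne'))).mul (dJ t)
    refine HasDerivAt.congr_deriv (f := stretchDensity n p G S κ) this ?_
    have e : stretchDensity n p G S κ t = τ t ^ (-(p / n)) * q t ^ (p / 2) * J t := rfl
    rw [e, Real.rpow_sub_one h1.ne', Real.rpow_sub_one h3.ne']
    simp only [hL, Pi.mul_apply]
    field_simp
    ring
  have ev : ∀ᶠ t in nhds (0 : ℝ), HasDerivAt (stretchDensity n p G S κ)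
      (stretchDensity n p G S κ t * L t) t := by
    have c1 := (dτ 0).continuousAt.eventually (lt_mem_nhds (b := τ 0) (by rw [τ0]; exact one_pos))
    have c2 := (dJ 0).continuousAt.eventually (lt_mem_nhds (b := J 0) (by rw [J0]; exact one_pos))
    have c3 := (dq 0 (by rw [J0]; exact one_ne_zero)).continuousAt.eventually
      (lt_mem_nhds (b := q 0) (by rw [q0]; exact one_pos))
    filter_upwards [c1, c2, c3] with t h1 h2 h3 using dφ t h1 h2 h3
  have dL : HasDerivAt L (p * n * G ^ 2 + p * κ * S * (2 * n * G + 3 * S - 2 * κ * S)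
      - (n * G + S) ^ 2) 0 := by
    have hJ0 : J 0 ≠ 0 := by rw [J0]; exact one_ne_zero
    have e1 := ((hasDerivAt_const (0 : ℝ) (1 : ℝ)).div (dτ 0)
      (by rw [τ0]; exact one_ne_zero)).const_mul (p * G)
    have e2 := ((dτ 0).div (((dJ 0).pow 3).mul (dq 0 hJ0))
      (by simp [J0, q0])).const_mul (p * κ * S)
    have e3 := ((hasDerivAt_const (0 : ℝ) (1 : ℝ)).div (dJ 0) hJ0).const_mul (n * G + S)
    refine ((e1.add e2).sub e3).congr_deriv ?_
    simp [τ0, J0, q0]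
    ring
  have hψ := (ev.self_of_nhds).mul dL
  have key := tendsto_second_difference ev hψ
  simp only [stretchDensity_zero, mul_one] at key
  convert key using 2
  simp only [hL, τ0, J0, q0]
  ring

section
variable {n : ℕ} {g γ u : Euc n → ℝ} {f : ℝ → ℝ} {R M p : ℝ}

lemma abs_radialDeriv_le (u : Euc n → ℝ) (x : Euc n) : |radialDeriv u x| ≤ ‖gradient u x‖ := by
  rw [radialDeriv, abs_div, abs_norm]
  exact div_le_of_le_mul₀ (norm_nonneg _) (norm_nonneg _)
    ((abs_real_inner_le_norm _ _).trans_eq (mul_comm _ _))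

lemma radialDeriv_div_norm_sq_mem_Icc (u : Euc n → ℝ) (x : Euc n) :
    (radialDeriv u x / ‖gradient u x‖) ^ 2 ∈ Icc (0 : ℝ) 1 := by
  refine ⟨sq_nonneg _, ?_⟩
  rw [sq_le_one_iff_abs_le_one, abs_div, abs_norm]
  exact div_le_one_of_le₀ (abs_radialDeriv_le u x) (norm_nonneg _)

/-- The integrand of the second inner variation of `∫ |∇u|^p` along `x ↦ g(x) x`, divided by
`p |∇u|^p`, where `G = g`, `S = x · ∇g` and `κ = u_r² / |∇u|²`. -/
def innerVariationWeight (n : ℕ) (p G S κ : ℝ) : ℝ :=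
  (p - n) * G ^ 2 + 2 * (p * κ - 1) * (G * S) + (κ + (p - 2) * κ ^ 2) * S ^ 2

theorem IsRadialCutoff.integral_innerVariationWeight_nonneg [NeZero n]
    (h : IsRadialCutoff g γ R M)
    (hp : 1 < p) (hf : ContDiff ℝ 1 f) (hu : ContDiff ℝ 1 u) (huc : HasCompactSupport u)
    (weak : ∀ ξ, ContDiff ℝ 1 ξ → tsupport ξ ⊆ closedBall (0 : Euc n) R →
      ∫ x, ‖gradient u x‖ ^ (p - 2) * ⟪gradient u x, gradient ξ x⟫ = ∫ x, f (u x) * ξ x)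
    (stab : ∀ ξ, ContDiff ℝ 1 ξ → tsupport ξ ⊆ closedBall (0 : Euc n) R →
      ∫ x, deriv f (u x) * ξ x ^ 2 ≤ ∫ x in {y | 0 < ‖gradient u y‖},
        (‖gradient u x‖ ^ (p - 2) * ‖gradient ξ x‖ ^ 2
          + (p - 2) * ‖gradient u x‖ ^ (p - 4) * ⟪gradient u x, gradient ξ x⟫ ^ 2)) :
    0 ≤ ∫ x, ‖gradient u x‖ ^ p * innerVariationWeight n p (g x) (γ x * ‖x‖ ^ 2)
      ((radialDeriv u x / ‖gradient u x‖) ^ 2) := by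
  have hsmall := eventually_abs_mul_le (by norm_num : (0 : ℝ) < 1 / 2) (n * M + 2 * M * R ^ 2)
  have i0 := integrable_norm_gradient_rpow hp hu huc
  set P : ℝ → Euc n → ℝ := fun t x => stretchDensity n p (g x) (γ x * ‖x‖ ^ 2)
    ((radialDeriv u x / ‖gradient u x‖) ^ 2) t with hP
  obtain ⟨C, hC, hCb⟩ := exists_eventually_abs_second_difference_le
    (F := fun w : ℝ × ℝ × ℝ × ℝ => stretchDensity n p w.2.1 w.2.2.1 w.2.2.2 w.1)
    ((isCompact_Icc (a := -M) (b := M)).prod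
      ((isCompact_Icc (a := -(M * R ^ 2)) (b := M * R ^ 2)).prod
        (isCompact_Icc (a := (0 : ℝ)) (b := 1))))
    (fun z _ => contDiffAt_stretchDensity n p z.1 z.2.1 z.2.2)
  have hb : ∀ᶠ t in nhdsWithin (0 : ℝ) {0}ᶜ, ∀ x, |P t x + P (-t) x - 2| ≤ C * t ^ 2 := by
    filter_upwards [nhdsWithin_le_nhds hCb] with t ht x
    have := ht (g x, γ x * ‖x‖ ^ 2, (radialDeriv u x / ‖gradient u x‖) ^ 2)
      ⟨abs_le.1 (h.abs_fun_le x), abs_le.1 (by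
        rw [abs_mul, abs_of_nonneg (sq_nonneg ‖x‖)]; exact h.abs_mul_norm_sq_le x),
        radialDeriv_div_norm_sq_mem_Icc u x⟩
    simpa only [stretchDensity_zero, mul_one] using this
  have key : Tendsto (fun t => ∫ x, ‖gradient u x‖ ^ p * ((P t x + P (-t) x - 2) / t ^ 2))
      (nhdsWithin 0 {0}ᶜ) (nhds (∫ x, ‖gradient u x‖ ^ p * (p *
        innerVariationWeight n p (g x) (γ x * ‖x‖ ^ 2)
          ((radialDeriv u x / ‖gradient u x‖) ^ 2)))) := by
    refine tendsto_integral_filter_of_dominated_convergence (fun x => ‖gradient u x‖ ^ p * C) ?_ ?_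
      (i0.mul_const C) (Eventually.of_forall fun x =>
        (tendsto_second_difference_stretchDensity p _ _ _).const_mul _)
    · filter_upwards [hsmall] with t ht
      have ht' : |-t| * (n * M + 2 * M * R ^ 2) ≤ 1 / 2 := by rwa [abs_neg]
      have i1 := h.integrable_norm_rpow_mul_stretchDensity ht hp hu huc
      have i2 := h.integrable_norm_rpow_mul_stretchDensity ht' hp hu huc
      refine (((i1.add i2).sub (i0.const_mul 2)).div_const (t ^ 2)).aestronglyMeasurable.congr
        (Eventually.of_forall fun x => ?_)
      simp only [hP, Pi.add_apply, Pi.sub_apply]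
      ring
    · filter_upwards [hb, self_mem_nhdsWithin] with t ht ht0
      refine Eventually.of_forall fun x => ?_
      have ht2 : 0 < t ^ 2 := by have : t ≠ 0 := ht0; positivity
      rw [norm_mul, Real.norm_eq_abs, Real.norm_eq_abs,
        abs_of_nonneg (Real.rpow_nonneg (norm_nonneg _) p), abs_div, abs_of_pos ht2]
      exact mul_le_mul_of_nonneg_left ((div_le_iff₀ ht2).2 (ht x))
        (Real.rpow_nonneg (norm_nonneg _) p)
  have hle : ∀ ε > 0, -ε ≤ ∫ x, ‖gradient u x‖ ^ p * (p *
        innerVariationWeight n p (g x) (γ x * ‖x‖ ^ 2)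
          ((radialDeriv u x / ‖gradient u x‖) ^ 2)) := fun ε hε => by
    refine ge_of_tendsto key ?_
    filter_upwards [h.eventually_neg_mul_sq_le_integral hp hf hu huc weak stab hε,
      self_mem_nhdsWithin] with t ht ht0
    have ht2 : 0 < t ^ 2 := by have : t ≠ 0 := ht0; positivity
    simp only [← mul_div_assoc]
    rw [integral_div, le_div_iff₀ ht2, neg_mul]
    exact ht
  have h0 : 0 ≤ ∫ x, ‖gradient u x‖ ^ p * (p *
        innerVariationWeight n p (g x) (γ x * ‖x‖ ^ 2)
          ((radialDeriv u x / ‖gradient u x‖) ^ 2)) :=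
    le_of_forall_pos_le_add fun ε hε => by linarith [hle ε hε]
  simp only [mul_left_comm _ p] at h0
  rw [integral_const_mul] at h0
  exact nonneg_of_mul_nonneg_right h0 (by linarith)
end

section
variable {n : ℕ} {g γ u : Euc n → ℝ} {f : ℝ → ℝ} {R M p : ℝ}

lemma exists_contDiff_hasCompactSupport_eqOn (hu : ContDiffOn ℝ 1 u (ball 0 1)) (hR₀ : 0 ≤ R)
    (hR : R < 1) :
    ∃ w : Euc n → ℝ, ContDiff ℝ 1 w ∧ HasCompactSupport w ∧
      ∀ x ∈ closedBall (0 : Euc n) R, w x = u x ∧ gradient w x = gradient u x := by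
  let φ : ContDiffBump (0 : Euc n) := ⟨(2 * R + 1) / 3, (R + 2) / 3, by linarith, by linarith⟩
  have hφ : φ.rIn = (2 * R + 1) / 3 := rfl
  have hφ' : φ.rOut = (R + 2) / 3 := rfl
  have hsub : tsupport (fun x => φ x * u x) ⊆ closedBall (0 : Euc n) ((R + 2) / 3) := by
    refine (closure_mono (Function.support_mul_subset_left _ _)).trans ?_
    rw [← hφ', ← φ.tsupport_eq, tsupport]
  refine ⟨fun x => φ x * u x, contDiff_iff_contDiffAt.2 fun x => ?_, ?_, fun x hx => ?_⟩
  · by_cases hx : x ∈ tsupport (fun x => φ x * u x)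
    swap
    · exact contDiffAt_const.congr_of_eventuallyEq (notMem_tsupport_iff_eventuallyEq.1 hx)
    refine φ.contDiffAt.mul ((hu x ?_).contDiffAt (isOpen_ball.mem_nhds ?_)) <;>
    · have := mem_closedBall_zero_iff.1 (hsub hx)
      rw [mem_ball_zero_iff]; linarith
  · exact HasCompactSupport.mul_right φ.hasCompactSupport
  · have hx' : x ∈ ball (0 : Euc n) φ.rIn := by
      rw [mem_closedBall_zero_iff] at hx
      rw [mem_ball_zero_iff, hφ]; linarith
    have he : (fun x => φ x * u x) =ᶠ[nhds x] u := by
      filter_upwards [isOpen_ball.mem_nhds hx'] with y hy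
      rw [φ.one_of_mem_closedBall (ball_subset_closedBall hy), one_mul]
    exact ⟨he.self_of_nhds, by rw [gradient, gradient, he.fderiv_eq]⟩

lemma measurable_gradient (u : Euc n → ℝ) : Measurable (gradient u) :=
  ((InnerProductSpace.toDual ℝ (Euc n)).symm.continuous.measurable).comp (measurable_fderiv ℝ u)

lemma gradient_eq_zero_of_notMem_tsupport {ξ : Euc n → ℝ} {x : Euc n} (hx : x ∉ tsupport ξ) :
    gradient ξ x = 0 := by
  have : ξ =ᶠ[nhds x] fun _ => 0 := notMem_tsupport_iff_eventuallyEq.1 hx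
  rw [gradient, this.fderiv_eq]; simp

theorem IsStableRegularSolution.integral_innerVariationWeight_nonneg [NeZero n]
    (hs : IsStableRegularSolution n p (ball 0 1) f u) (hp : 1 < p) (hf : ContDiff ℝ 1 f)
    (h : IsRadialCutoff g γ R M) (hR : R < 1) :
    0 ≤ ∫ x in closedBall (0 : Euc n) R, ‖gradient u x‖ ^ p *
      innerVariationWeight n p (g x) (γ x * ‖x‖ ^ 2)
        ((radialDeriv u x / ‖gradient u x‖) ^ 2) := by
  obtain ⟨⟨hu, -, hweak⟩, hstab⟩ := hs
  obtain ⟨w, hw, hwc, hwu⟩ := exists_contDiff_hasCompactSupport_eqOn hu h.radius_nonneg hR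
  have hKU : closedBall (0 : Euc n) R ⊆ ball 0 1 := closedBall_subset_ball hR
  have hcs : ∀ {ξ : Euc n → ℝ}, tsupport ξ ⊆ closedBall (0 : Euc n) R → HasCompactSupport ξ :=
    fun hξ => (isCompact_closedBall _ _).of_isClosed_subset (isClosed_tsupport _) hξ
  have hoff : ∀ {ξ : Euc n → ℝ}, tsupport ξ ⊆ closedBall (0 : Euc n) R →
      ∀ x ∉ closedBall (0 : Euc n) R, ξ x = 0 ∧ gradient ξ x = 0 := fun hξ x hx =>
    ⟨image_eq_zero_of_notMem_tsupport fun h => hx (hξ h),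
      gradient_eq_zero_of_notMem_tsupport fun h => hx (hξ h)⟩
  have hball : ∀ {F F' : Euc n → ℝ}, (∀ x ∈ closedBall (0 : Euc n) R, F' x = F x) →
      (∀ x ∉ closedBall (0 : Euc n) R, F x = 0 ∧ F' x = 0) →
      ∫ x, F' x = ∫ x in ball (0 : Euc n) 1, F x := fun h1 h2 => by
    rw [← integral_indicator measurableSet_ball]
    refine integral_congr_ae (Eventually.of_forall fun x => ?_)
    by_cases hx : x ∈ closedBall (0 : Euc n) R
    · simp only [indicator_of_mem (hKU hx), h1 x hx]
    · simp only [indicator, (h2 x hx).1, (h2 x hx).2, ite_self]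
  have key := h.integral_innerVariationWeight_nonneg hp hf hw hwc
    (fun ξ hξ hξs => by
      have e := hweak ξ hξ (hcs hξs) (hξs.trans hKU)
      rwa [← hball (F' := fun x => ‖gradient w x‖ ^ (p - 2) * ⟪gradient w x, gradient ξ x⟫)
          (fun x hx => by rw [(hwu x hx).2]) (fun x hx => by simp [(hoff hξs x hx).2]),
        ← hball (F' := fun x => f (w x) * ξ x)
          (fun x hx => by rw [(hwu x hx).1]) (fun x hx => by simp [(hoff hξs x hx).1])] at e)
    (fun ξ hξ hξs => by
      have e := hstab ξ ⟨_, (hξ.lipschitzWith_of_hasCompactSupport (hcs hξs)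
        one_ne_zero).choose_spec⟩ (hcs hξs) (hξs.trans hKU)
      rw [sub_nonneg, ← hball (F' := fun x => deriv f (w x) * ξ x ^ 2)
        (fun x hx => by rw [(hwu x hx).1]) (fun x hx => by simp [(hoff hξs x hx).1])] at e
      refine e.trans_eq ?_
      have hm : ∀ v : Euc n → ℝ, MeasurableSet {y | 0 < ‖gradient v y‖} := fun v =>
        measurableSet_lt measurable_const (measurable_gradient v).norm
      rw [← integral_indicator (measurableSet_ball.inter (hm u)), ← integral_indicator (hm w)]
      refine integral_congr_ae (Eventually.of_forall fun x => ?_)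
      by_cases hx : x ∈ closedBall (0 : Euc n) R
      · simp only [indicator, mem_inter_iff, mem_ofPred_eq, (hwu x hx).2, hKU hx, true_and]
      · simp [indicator, (hoff hξs x hx).2])
  rw [← integral_indicator measurableSet_closedBall]
  refine key.trans_eq (integral_congr_ae (Eventually.of_forall fun x => ?_))
  by_cases hx : x ∈ closedBall (0 : Euc n) R
  · simp only [indicator_of_mem hx, radialDeriv, (hwu x hx).2]
  · have hx' : R < ‖x‖ := by rwa [mem_closedBall_zero_iff, not_le] at hx
    simp [indicator_of_notMem hx, h.eq_zero x hx', h.eq_zero' x hx', innerVariationWeight]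
end

section
variable {n : ℕ} {u : Euc n → ℝ} {f χ χ' : ℝ → ℝ} {R B p a ε ρ : ℝ}

/-- `χ` is a `C¹` cutoff, equal to `1` on `(-∞, 1]` and to `0` on `[2, ∞)`, with derivative `χ'`. -/
structure IsStepCutoff (χ χ' : ℝ → ℝ) (B : ℝ) : Prop where
  hasDerivAt : ∀ z, HasDerivAt χ (χ' z) z
  continuous : Continuous χ'
  abs_le_one : ∀ z, |χ z| ≤ 1
  abs_mul_deriv_le : ∀ z, |z * χ' z| ≤ B
  eq_one : ∀ z < 1, χ z = 1
  deriv_eq_zero : ∀ z < 1, χ' z = 0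
  eq_zero : ∀ z, 2 < z → χ z = 0
  deriv_eq_zero' : ∀ z, 2 < z → χ' z = 0

lemma exists_isStepCutoff : ∃ χ χ' B, IsStepCutoff χ χ' B := by
  set χ : ℝ → ℝ := fun z => Real.smoothTransition (2 - z)
  have hχ : ContDiff ℝ 1 χ := Real.smoothTransition.contDiff.comp (contDiff_const.sub contDiff_id)
  have h1 : ∀ z < 1, χ z = 1 := fun z hz => Real.smoothTransition.one_of_one_le (by linarith)
  have h0 : ∀ z, 2 < z → χ z = 0 := fun z hz => Real.smoothTransition.zero_of_nonpos (by linarith)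
  have h1' : ∀ z < 1, deriv χ z = 0 := fun z hz => by
    have : χ =ᶠ[nhds z] fun _ => 1 := by
      filter_upwards [Iio_mem_nhds hz] with y hy using h1 y hy
    rw [this.deriv_eq, deriv_const]
  have h0' : ∀ z, 2 < z → deriv χ z = 0 := fun z hz => by
    have : χ =ᶠ[nhds z] fun _ => 0 := by
      filter_upwards [Ioi_mem_nhds hz] with y hy using h0 y hy
    rw [this.deriv_eq, deriv_const]
  have hc : Continuous (deriv χ) := hχ.continuous_deriv le_rfl
  obtain ⟨B, hB⟩ := (isCompact_Icc (a := (1 : ℝ)) (b := 2)).exists_bound_of_continuousOn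
    (continuous_id.mul hc).continuousOn
  refine ⟨χ, deriv χ, B, fun z => (hχ.differentiable one_ne_zero z).hasDerivAt, hc, fun z => ?_,
    fun z => ?_, h1, h1', h0, h0'⟩
  · rw [abs_of_nonneg (Real.smoothTransition.nonneg _)]
    exact Real.smoothTransition.le_one _
  · by_cases hz : z ∈ Icc (1 : ℝ) 2
    · exact hB z hz
    · have : deriv χ z = 0 := by
        rw [mem_Icc, not_and_or, not_le, not_le] at hz
        exact hz.elim (h1' z) (h0' z)
      rw [this, mul_zero, abs_zero]
      exact (norm_nonneg _).trans (hB 1 (by norm_num))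

/-- The regularization `(|x|² + ε)^{-a/4} χ(|x|²/ρ²)` of `|x|^{-a/2} χ(|x|²/ρ²)`. -/
def powerCutoff (χ : ℝ → ℝ) (a ρ ε : ℝ) (x : Euc n) : ℝ :=
  (‖x‖ ^ 2 + ε) ^ (-a / 4) * χ (‖x‖ ^ 2 / ρ ^ 2)

/-- The slope `γ` of `g = powerCutoff χ a ρ ε`, determined by `∇g(x) = γ(x) x`. -/
def powerCutoffSlope (χ χ' : ℝ → ℝ) (a ρ ε : ℝ) (x : Euc n) : ℝ :=
  2 * (-a / 4 * (‖x‖ ^ 2 + ε) ^ (-a / 4 - 1) * χ (‖x‖ ^ 2 / ρ ^ 2) +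
    (‖x‖ ^ 2 + ε) ^ (-a / 4) * (χ' (‖x‖ ^ 2 / ρ ^ 2) / ρ ^ 2))

/-- `(|x|² + ε)^{a/4}` times the logarithmic radial slope of `powerCutoff χ a ρ ε`. -/
def powerCutoffFactor (χ χ' : ℝ → ℝ) (a ρ ε : ℝ) (x : Euc n) : ℝ :=
  2 * (-a / 4 * (‖x‖ ^ 2 / (‖x‖ ^ 2 + ε)) * χ (‖x‖ ^ 2 / ρ ^ 2) +
    ‖x‖ ^ 2 / ρ ^ 2 * χ' (‖x‖ ^ 2 / ρ ^ 2))

lemma powerCutoffSlope_mul_norm_sq (hε : 0 < ε) (x : Euc n) :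
    powerCutoffSlope χ χ' a ρ ε x * ‖x‖ ^ 2 =
      (‖x‖ ^ 2 + ε) ^ (-a / 4) * powerCutoffFactor χ χ' a ρ ε x := by
  have h : 0 < ‖x‖ ^ 2 + ε := by positivity
  rw [powerCutoffSlope, powerCutoffFactor, Real.rpow_sub_one h.ne']
  ring

lemma IsStepCutoff.abs_powerCutoffFactor_le (h : IsStepCutoff χ χ' B) (hε : 0 ≤ ε) (x : Euc n) :
    |powerCutoffFactor χ χ' a ρ ε x| ≤ |a| / 2 + 2 * B := by
  have h1 : |‖x‖ ^ 2 / (‖x‖ ^ 2 + ε)| ≤ 1 := by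
    rw [abs_of_nonneg (by positivity)]
    exact div_le_one_of_le₀ (by linarith) (by positivity)
  have h2 := mul_le_one₀ h1 (abs_nonneg _) (h.abs_le_one (‖x‖ ^ 2 / ρ ^ 2))
  have h3 := h.abs_mul_deriv_le (‖x‖ ^ 2 / ρ ^ 2)
  rw [← abs_mul] at h2
  rw [powerCutoffFactor, abs_mul, abs_two, mul_assoc (-a / 4)]
  refine (mul_le_mul_of_nonneg_left (abs_add_le _ _) zero_le_two).trans ?_
  rw [abs_mul (-a / 4), abs_div, abs_neg, abs_of_pos (by norm_num : (0 : ℝ) < 4)]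
  nlinarith [mul_le_mul_of_nonneg_left h2 (by positivity : 0 ≤ |a| / 4)]

lemma IsStepCutoff.isRadialCutoff (h : IsStepCutoff χ χ' B) (hε : 0 < ε) (hρ : 0 < ρ)
    (hR : 3 * ρ / 2 ≤ R) :
    ∃ M, IsRadialCutoff (n := n) (powerCutoff χ a ρ ε) (powerCutoffSlope χ χ' a ρ ε) R M := by
  have hpos : ∀ x : Euc n, 0 < ‖x‖ ^ 2 + ε := fun x => by positivity
  have hχ : Continuous χ := continuous_iff_continuousAt.2 fun z => (h.hasDerivAt z).continuousAt
  have hχ' := h.continuous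
  have hz : Continuous fun x : Euc n => ‖x‖ ^ 2 + ε := by fun_prop
  have c1 : Continuous (powerCutoff (n := n) χ a ρ ε) :=
    (hz.rpow_const fun x => Or.inl (hpos x).ne').mul (hχ.comp (by fun_prop))
  have c2 : Continuous (powerCutoffSlope (n := n) χ χ' a ρ ε) :=
    continuous_const.mul (((continuous_const.mul
      (hz.rpow_const fun x => Or.inl (hpos x).ne')).mul (hχ.comp (by fun_prop))).add
      ((hz.rpow_const fun x => Or.inl (hpos x).ne').mul
        ((hχ'.comp (by fun_prop)).div_const _)))
  have hlarge : ∀ x : Euc n, R < ‖x‖ → 2 < ‖x‖ ^ 2 / ρ ^ 2 := fun x hx => by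
    rw [lt_div_iff₀ (by positivity)]
    nlinarith
  have z1 : ∀ x : Euc n, R < ‖x‖ → powerCutoff χ a ρ ε x = 0 := fun x hx => by
    rw [powerCutoff, h.eq_zero _ (hlarge x hx), mul_zero]
  have z2 : ∀ x : Euc n, R < ‖x‖ → powerCutoffSlope χ χ' a ρ ε x = 0 := fun x hx => by
    rw [powerCutoffSlope, h.eq_zero _ (hlarge x hx), h.deriv_eq_zero' _ (hlarge x hx)]; simp
  obtain ⟨M₁, hM₁⟩ := (isCompact_closedBall (0 : Euc n) R).exists_bound_of_continuousOn
    c1.continuousOn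
  obtain ⟨M₂, hM₂⟩ := (isCompact_closedBall (0 : Euc n) R).exists_bound_of_continuousOn
    c2.continuousOn
  have h0 : (0 : Euc n) ∈ closedBall (0 : Euc n) R := mem_closedBall_self (by linarith)
  have p1 := (norm_nonneg _).trans (hM₁ 0 h0)
  have p2 := (norm_nonneg _).trans (hM₂ 0 h0)
  refine ⟨max M₁ M₂, fun x => ?_, c2, fun x => ?_, fun x => ?_, z1, z2, by linarith⟩
  · have d1 : HasFDerivAt (fun x : Euc n => ‖x‖ ^ 2) (2 • innerSL ℝ x) x :=
      (hasStrictFDerivAt_norm_sq x).hasFDerivAt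
    have d2 : HasDerivAt (fun q : ℝ => (q + ε) ^ (-a / 4) * χ (q / ρ ^ 2)) _ (‖x‖ ^ 2) :=
      (((hasDerivAt_id _).add_const ε).rpow_const (p := -a / 4) (Or.inl (hpos x).ne')).mul
        ((h.hasDerivAt (‖x‖ ^ 2 / ρ ^ 2)).comp (‖x‖ ^ 2) ((hasDerivAt_id _).div_const (ρ ^ 2)))
    refine (d2.comp_hasFDerivAt x d1).congr_fderiv ?_
    ext y
    simp [powerCutoffSlope]
    ring
  · rcases lt_or_ge R ‖x‖ with hx | hx
    · rw [z1 x hx, abs_zero]; exact p1.trans (le_max_left _ _)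
    · exact (hM₁ x (mem_closedBall_zero_iff.2 hx)).trans (le_max_left _ _)
  · rcases lt_or_ge R ‖x‖ with hx | hx
    · rw [z2 x hx, abs_zero]; exact p2.trans (le_max_right _ _)
    · exact (hM₂ x (mem_closedBall_zero_iff.2 hx)).trans (le_max_right _ _)

lemma innerVariationWeight_mul (n : ℕ) (p c G S κ : ℝ) :
    innerVariationWeight n p (c * G) (c * S) κ = c ^ 2 * innerVariationWeight n p G S κ := by
  unfold innerVariationWeight; ring

lemma abs_innerVariationWeight_le (n : ℕ) (p : ℝ) {G S κ K : ℝ} (hG : |G| ≤ 1) (hS : |S| ≤ K)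
    (hκ : κ ∈ Icc (0 : ℝ) 1) :
    |innerVariationWeight n p G S κ| ≤
      |p - n| + 2 * (|p| + 1) * K + (1 + |p - 2|) * K ^ 2 := by
  have hκ' : |κ| ≤ 1 := by rw [abs_of_nonneg hκ.1]; exact hκ.2
  have hK : 0 ≤ K := (abs_nonneg _).trans hS
  have h1 : |(p - n) * G ^ 2| ≤ |p - n| := by
    rw [abs_mul, abs_pow]
    exact mul_le_of_le_one_right (abs_nonneg _) (pow_le_one₀ (abs_nonneg _) hG)
  have h2 : |2 * (p * κ - 1) * (G * S)| ≤ 2 * (|p| + 1) * K := by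
    rw [abs_mul, abs_mul, abs_mul G, abs_two]
    have e1 : |p * κ - 1| ≤ |p| + 1 := (abs_sub _ _).trans (by
      rw [abs_one, abs_mul]
      exact add_le_add_left (mul_le_of_le_one_right (abs_nonneg _) hκ') _)
    have e2 : |G| * |S| ≤ K := by
      simpa using mul_le_mul hG hS (abs_nonneg _) zero_le_one
    exact mul_le_mul (mul_le_mul_of_nonneg_left e1 zero_le_two) e2 (by positivity) (by positivity)
  have h3 : |(κ + (p - 2) * κ ^ 2) * S ^ 2| ≤ (1 + |p - 2|) * K ^ 2 := by
    rw [abs_mul, abs_pow]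
    have e1 : |κ + (p - 2) * κ ^ 2| ≤ 1 + |p - 2| := (abs_add_le _ _).trans (by
      rw [abs_mul, abs_pow]
      exact add_le_add hκ' (mul_le_of_le_one_right (abs_nonneg _) (pow_le_one₀ (abs_nonneg _) hκ')))
    exact mul_le_mul e1 (pow_le_pow_left₀ (abs_nonneg _) hS 2) (by positivity) (by positivity)
  unfold innerVariationWeight
  exact (abs_add_le _ _).trans (add_le_add ((abs_add_le _ _).trans (add_le_add h1 h2)) h3)

lemma measurable_radialDeriv (u : Euc n → ℝ) : Measurable (radialDeriv u) :=
  (measurable_id.inner (measurable_gradient u)).div measurable_norm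

lemma Measurable.innerVariationWeight {α : Type*} [MeasurableSpace α] {G S κ : α → ℝ}
    (hG : Measurable G) (hS : Measurable S) (hκ : Measurable κ) (n : ℕ) (p : ℝ) :
    Measurable fun x => innerVariationWeight n p (G x) (S x) (κ x) := by
  unfold _root_.innerVariationWeight
  fun_prop
end

section
variable {n : ℕ} {u : Euc n → ℝ} {f χ χ' : ℝ → ℝ} {B p a ε ρ : ℝ}

lemma sq_rpow_neg_div_four {q : ℝ} (hq : 0 ≤ q) (a : ℝ) : (q ^ (-a / 4)) ^ 2 = q ^ (-a / 2) := by
  rw [← Real.rpow_natCast, ← Real.rpow_mul hq]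
  congr 1
  push_cast
  ring

lemma norm_sq_rpow_neg_div_two (x : Euc n) (a : ℝ) : (‖x‖ ^ 2) ^ (-a / 2) = ‖x‖ ^ (-a) := by
  rw [← Real.rpow_natCast, ← Real.rpow_mul (norm_nonneg x)]
  congr 1
  push_cast
  ring

lemma norm_sq_add_rpow_le {x : Euc n} (hx : x ≠ 0) (hx' : ‖x‖ ≤ 1) (hε : 0 ≤ ε) (hε' : ε ≤ 1) :
    (‖x‖ ^ 2 + ε) ^ (-a / 2) ≤ ‖x‖ ^ (-a) + 2 ^ (-a / 2) := by
  have hq : 0 < ‖x‖ ^ 2 := by have := norm_pos_iff.2 hx; positivity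
  rcases le_total 0 a with ha | ha
  · have h1 : (‖x‖ ^ 2 + ε) ^ (-a / 2) ≤ (‖x‖ ^ 2) ^ (-a / 2) :=
      Real.rpow_le_rpow_of_nonpos hq (by linarith) (by linarith)
    rw [norm_sq_rpow_neg_div_two] at h1
    have : (0 : ℝ) ≤ 2 ^ (-a / 2) := by positivity
    linarith
  · have h1 : (‖x‖ ^ 2 + ε) ^ (-a / 2) ≤ 2 ^ (-a / 2) :=
      Real.rpow_le_rpow (by positivity) (by nlinarith [norm_nonneg x]) (by linarith)
    have : 0 ≤ ‖x‖ ^ (-a) := by positivity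
    linarith

lemma continuous_innerVariationWeight (n : ℕ) (p G κ : ℝ) :
    Continuous fun S => innerVariationWeight n p G S κ := by
  unfold innerVariationWeight
  fun_prop

lemma exists_norm_gradient_rpow_le (hu : ContDiffOn ℝ 1 u (ball 0 1)) (hp : 0 ≤ p) {R : ℝ}
    (hR₀ : 0 ≤ R) (hR : R < 1) :
    ∃ D, 0 ≤ D ∧ ∀ x ∈ closedBall (0 : Euc n) R, ‖gradient u x‖ ^ p ≤ D := by
  obtain ⟨w, hw, -, hwu⟩ := exists_contDiff_hasCompactSupport_eqOn hu hR₀ hR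
  obtain ⟨D, hD⟩ := (isCompact_closedBall (0 : Euc n) R).exists_bound_of_continuousOn
    hw.continuous_gradient.continuousOn
  have hD0 := (norm_nonneg _).trans (hD 0 (mem_closedBall_self hR₀))
  refine ⟨D ^ p, by positivity, fun x hx => Real.rpow_le_rpow (norm_nonneg _) ?_ hp⟩
  rw [← (hwu x hx).2]
  exact hD x hx

lemma integrableOn_closedBall_norm_rpow_neg [NeZero n] (ha : a < n) (R : ℝ) :
    IntegrableOn (fun x : Euc n => ‖x‖ ^ (-a)) (closedBall 0 R) := by
  refine (integrableOn_ball_of_norm_le_rpow (r := R + 1) (C := 1) (α := a) ?_ ?_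
    (Eventually.of_forall fun x => ?_) ?_).mono_set (closedBall_subset_ball (by linarith))
  · rw [finrank_euclideanSpace_fin]; exact NeZero.one_le
  · rwa [finrank_euclideanSpace_fin]
  · rw [one_mul, Real.norm_of_nonneg (by positivity)]
  · exact (measurable_norm.pow_const _).aestronglyMeasurable

theorem IsStableRegularSolution.integral_powerCutoff_nonneg [NeZero n]
    (hs : IsStableRegularSolution n p (ball 0 1) f u) (hp : 1 < p) (hf : ContDiff ℝ 1 f)
    (h : IsStepCutoff χ χ' B) (ha : a < n) (hρ : ρ ∈ Ioo (0 : ℝ) (2 / 3)) :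
    0 ≤ ∫ x in closedBall (0 : Euc n) (3 * ρ / 2), ‖gradient u x‖ ^ p * (‖x‖ ^ (-a) *
      innerVariationWeight n p (χ (‖x‖ ^ 2 / ρ ^ 2)) (powerCutoffFactor χ χ' a ρ 0 x)
        ((radialDeriv u x / ‖gradient u x‖) ^ 2)) := by
  obtain ⟨hρ₀, hρ₁⟩ := hρ
  obtain ⟨D, hD, hDu⟩ := exists_norm_gradient_rpow_le hs.1.1 (by linarith : 0 ≤ p)
    (by linarith : 0 ≤ 3 * ρ / 2) (by linarith)
  set κ : Euc n → ℝ := fun x => (radialDeriv u x / ‖gradient u x‖) ^ 2 with hκ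
  have hκm : Measurable κ := ((measurable_radialDeriv u).div (measurable_gradient u).norm).pow_const 2
  set K := |a| / 2 + 2 * B with hK
  set W := |p - n| + 2 * (|p| + 1) * K + (1 + |p - 2|) * K ^ 2
  have hne : ∀ᵐ x ∂volume.restrict (closedBall (0 : Euc n) (3 * ρ / 2)), x ≠ 0 :=
    ae_restrict_of_ae (Measure.ae_ne volume 0)
  have hlim : Tendsto (fun ε => ∫ x in closedBall (0 : Euc n) (3 * ρ / 2), ‖gradient u x‖ ^ p *
      innerVariationWeight n p (powerCutoff χ a ρ ε x) (powerCutoffSlope χ χ' a ρ ε x * ‖x‖ ^ 2)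
        (κ x)) (nhdsWithin 0 (Ioi 0)) (nhds (∫ x in closedBall (0 : Euc n) (3 * ρ / 2),
      ‖gradient u x‖ ^ p * (‖x‖ ^ (-a) *
        innerVariationWeight n p (χ (‖x‖ ^ 2 / ρ ^ 2)) (powerCutoffFactor χ χ' a ρ 0 x) (κ x)))) := by
    refine tendsto_integral_filter_of_dominated_convergence
      (fun x => D * ((‖x‖ ^ (-a) + 2 ^ (-a / 2)) * W)) ?_ ?_ ?_ ?_
    · filter_upwards [self_mem_nhdsWithin] with ε hε
      obtain ⟨M, hM⟩ := h.isRadialCutoff (n := n) (a := a) hε hρ₀ le_rfl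
      exact (((measurable_gradient u).norm.pow_const p).mul
        (hM.contDiff.continuous.measurable.innerVariationWeight
          (hM.continuous.measurable.mul (measurable_norm.pow_const 2)) hκm n p)).aestronglyMeasurable
    · filter_upwards [self_mem_nhdsWithin, nhdsWithin_le_nhds (Iic_mem_nhds one_pos)] with ε hε hε'
      filter_upwards [hne, ae_restrict_mem measurableSet_closedBall] with x hx hxR
      have hε₀ : (0 : ℝ) < ε := hε
      have hx1 : ‖x‖ ≤ 1 := (mem_closedBall_zero_iff.1 hxR).trans (by linarith)
      have hW := abs_innerVariationWeight_le n p (h.abs_le_one (‖x‖ ^ 2 / ρ ^ 2))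
        (h.abs_powerCutoffFactor_le (a := a) (ρ := ρ) hε₀.le x)
        (radialDeriv_div_norm_sq_mem_Icc u x)
      rw [powerCutoffSlope_mul_norm_sq hε₀, powerCutoff, innerVariationWeight_mul,
        sq_rpow_neg_div_four (by positivity), norm_mul, norm_mul,
        Real.norm_of_nonneg (by positivity : 0 ≤ ‖gradient u x‖ ^ p),
        Real.norm_of_nonneg (by positivity : 0 ≤ (‖x‖ ^ 2 + ε) ^ (-a / 2))]
      exact mul_le_mul (hDu x hxR) (mul_le_mul (norm_sq_add_rpow_le hx hx1 hε₀.le hε') hW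
        (norm_nonneg _) (by positivity)) (by positivity) hD
    · exact (((integrableOn_closedBall_norm_rpow_neg ha _).add
        (integrableOn_const (measure_closedBall_lt_top.ne))).mul_const W).const_mul D
    · filter_upwards [hne] with x hx
      have hq : ‖x‖ ^ 2 + 0 ≠ 0 := by simpa using hx
      have c0 : ContinuousAt (fun ε : ℝ => ‖x‖ ^ 2 + ε) 0 := by fun_prop
      have c1 : ContinuousAt (fun ε : ℝ => (‖x‖ ^ 2 + ε) ^ (-a / 4)) 0 :=
        c0.rpow_const (Or.inl hq)
      have c2 : ContinuousAt (fun ε => powerCutoffFactor χ χ' a ρ ε x) 0 := by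
        unfold powerCutoffFactor
        exact continuousAt_const.mul (((continuousAt_const.mul
          (continuousAt_const.div c0 hq)).mul continuousAt_const).add continuousAt_const)
      have c3 : ContinuousAt (fun ε => ‖gradient u x‖ ^ p * (((‖x‖ ^ 2 + ε) ^ (-a / 4)) ^ 2 *
          innerVariationWeight n p (χ (‖x‖ ^ 2 / ρ ^ 2)) (powerCutoffFactor χ χ' a ρ ε x)
            (κ x))) 0 :=
        continuousAt_const.mul ((c1.pow 2).mul
          ((continuous_innerVariationWeight n p _ (κ x)).continuousAt.comp c2))
      have e : ((‖x‖ ^ 2 + 0) ^ (-a / 4)) ^ 2 = ‖x‖ ^ (-a) := by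
        rw [add_zero, sq_rpow_neg_div_four (by positivity), norm_sq_rpow_neg_div_two]
      have c4 := c3.tendsto
      rw [e] at c4
      refine (c4.mono_left nhdsWithin_le_nhds).congr' ?_
      filter_upwards [self_mem_nhdsWithin] with ε hε
      rw [powerCutoffSlope_mul_norm_sq hε, powerCutoff, innerVariationWeight_mul]
  refine ge_of_tendsto hlim ?_
  filter_upwards [self_mem_nhdsWithin] with ε hε
  obtain ⟨M, hM⟩ := h.isRadialCutoff (n := n) (a := a) hε hρ₀ le_rfl
  exact hs.integral_innerVariationWeight_nonneg hp hf hM (by linarith)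

lemma integrableOn_norm_gradient_rpow_mul [NeZero n] (hu : ContDiffOn ℝ 1 u (ball 0 1))
    (hp : 0 ≤ p) (ha : a < n) {R C : ℝ} (hR₀ : 0 ≤ R) (hR : R < 1) {F : Euc n → ℝ}
    (hF : Measurable F) (hC : ∀ x, |F x| ≤ C) :
    IntegrableOn (fun x => ‖x‖ ^ (-a) * ‖gradient u x‖ ^ p * F x) (closedBall 0 R) := by
  obtain ⟨D, hD, hDu⟩ := exists_norm_gradient_rpow_le hu hp hR₀ hR
  refine Integrable.mono' (((integrableOn_closedBall_norm_rpow_neg ha R).mul_const D).mul_const C)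
    (((measurable_norm.pow_const _).mul
      ((measurable_gradient u).norm.pow_const _)).mul hF).aestronglyMeasurable ?_
  filter_upwards [ae_restrict_mem measurableSet_closedBall] with x hx
  rw [norm_mul, norm_mul, Real.norm_of_nonneg (by positivity : 0 ≤ ‖x‖ ^ (-a)),
    Real.norm_of_nonneg (by positivity : 0 ≤ ‖gradient u x‖ ^ p)]
  exact mul_le_mul (mul_le_mul_of_nonneg_left (hDu x hx) (by positivity)) (hC x) (norm_nonneg _)
    (by positivity)

lemma rpow_mul_div_pow {v s : ℝ} (hv : 0 ≤ v) (hs : |s| ≤ v) (p : ℝ) {k : ℕ} (hk : k ≠ 0) :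
    v ^ p * (s / v) ^ k = v ^ (p - k) * s ^ k := by
  rcases hv.eq_or_lt with rfl | hv
  · have : s = 0 := abs_nonpos_iff.1 hs
    simp [this, hk]
  · rw [Real.rpow_sub_natCast hv.ne', div_pow]
    ring

lemma innerVariationWeight_one (n : ℕ) (p a κ : ℝ) :
    innerVariationWeight n p 1 (-a / 2) κ =
      -((n - p - a) + (p * a - a ^ 2 / 4) * κ - a ^ 2 / 4 * (p - 2) * κ ^ 2) := by
  unfold innerVariationWeight; ring
end

section
variable {n : ℕ} {u : Euc n → ℝ} {f χ χ' : ℝ → ℝ} {B p a ε ρ : ℝ}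

lemma IsStepCutoff.powerCutoffFactor_eq (h : IsStepCutoff χ χ' B) (hρ : 0 < ρ) {x : Euc n}
    (hx : x ≠ 0) (hxρ : x ∈ ball (0 : Euc n) ρ) :
    χ (‖x‖ ^ 2 / ρ ^ 2) = 1 ∧ powerCutoffFactor χ χ' a ρ 0 x = -a / 2 := by
  have hz : ‖x‖ ^ 2 / ρ ^ 2 < 1 := by
    rw [div_lt_one (by positivity)]
    exact pow_lt_pow_left₀ (mem_ball_zero_iff.1 hxρ) (norm_nonneg _) two_ne_zero
  have hq : ‖x‖ ^ 2 ≠ 0 := by simpa using hx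
  refine ⟨h.eq_one _ hz, ?_⟩
  rw [powerCutoffFactor, h.eq_one _ hz, h.deriv_eq_zero _ hz, add_zero, div_self hq]
  ring

lemma ball_ae_eq_closedBall {R : ℝ} (hR : R ≠ 0) :
    closedBall (0 : Euc n) R =ᵐ[volume] ball (0 : Euc n) R := by
  rw [← ball_union_sphere]
  exact union_ae_eq_left_of_ae_eq_empty
    (ae_eq_empty.2 (Measure.addHaar_sphere_of_ne_zero volume _ hR))

theorem IsStableRegularSolution.weighted_integral_le [NeZero n]
    (hs : IsStableRegularSolution n p (ball 0 1) f u) (hp : 1 < p) (hf : ContDiff ℝ 1 f)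
    (h : IsStepCutoff χ χ' B) (ha : a < n) (hρ : ρ ∈ Ioo (0 : ℝ) (2 / 3)) :
    (n - p - a) * (∫ x in ball (0 : Euc n) ρ, ‖x‖ ^ (-a) * ‖gradient u x‖ ^ p)
        + (p * a - a ^ 2 / 4) * (∫ x in ball (0 : Euc n) ρ,
          ‖x‖ ^ (-a) * ‖gradient u x‖ ^ (p - 2) * radialDeriv u x ^ 2)
        - a ^ 2 / 4 * (p - 2) * (∫ x in ball (0 : Euc n) ρ,
          ‖x‖ ^ (-a) * ‖gradient u x‖ ^ (p - 4) * radialDeriv u x ^ 4)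
      ≤ (|p - n| + 2 * (|p| + 1) * (|a| / 2 + 2 * B) + (1 + |p - 2|) * (|a| / 2 + 2 * B) ^ 2) *
        ∫ x in ball (0 : Euc n) (3 * ρ / 2) \ ball (0 : Euc n) ρ,
          ‖x‖ ^ (-a) * ‖gradient u x‖ ^ p := by
  have key := hs.integral_powerCutoff_nonneg hp hf h ha hρ
  obtain ⟨hρ₀, hρ₁⟩ := hρ
  set W := |p - n| + 2 * (|p| + 1) * (|a| / 2 + 2 * B) + (1 + |p - 2|) * (|a| / 2 + 2 * B) ^ 2
  set κ : Euc n → ℝ := fun x => (radialDeriv u x / ‖gradient u x‖) ^ 2 with hκ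
  set A : Euc n → ℝ := fun x => ‖x‖ ^ (-a) * ‖gradient u x‖ ^ p with hA
  set V : Euc n → ℝ := fun x => innerVariationWeight n p (χ (‖x‖ ^ 2 / ρ ^ 2))
    (powerCutoffFactor χ χ' a ρ 0 x) (κ x) with hV
  have hκ01 : ∀ x, κ x ∈ Icc (0 : ℝ) 1 := radialDeriv_div_norm_sq_mem_Icc u
  have hκm : Measurable κ := ((measurable_radialDeriv u).div (measurable_gradient u).norm).pow_const 2
  have hχ : Measurable χ :=
    (continuous_iff_continuousAt.2 fun z => (h.hasDerivAt z).continuousAt).measurable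
  have hχ' : Measurable χ' := h.continuous.measurable
  have hVm : Measurable V := by
    refine Measurable.innerVariationWeight (by fun_prop) ?_ hκm n p
    unfold powerCutoffFactor
    fun_prop
  have hVb : ∀ x, |V x| ≤ W := fun x => abs_innerVariationWeight_le n p (h.abs_le_one _)
    (h.abs_powerCutoffFactor_le le_rfl x) (hκ01 x)
  have hI : ∀ {F : Euc n → ℝ} {C : ℝ}, Measurable F → (∀ x, |F x| ≤ C) →
      IntegrableOn (fun x => A x * F x) (ball 0 (3 * ρ / 2)) := fun hF hC =>
    (integrableOn_norm_gradient_rpow_mul hs.1.1 (by linarith) ha (by linarith) (by linarith)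
      hF hC).mono_set ball_subset_closedBall
  have hsub : ball (0 : Euc n) ρ ⊆ ball 0 (3 * ρ / 2) := ball_subset_ball (by linarith)
  have iA : IntegrableOn A (ball 0 (3 * ρ / 2)) := by
    simpa using hI (F := fun _ => 1) (C := 1) measurable_const (by simp)
  have iκ : IntegrableOn (fun x => A x * κ x) (ball 0 ρ) :=
    (hI (C := 1) hκm fun x => by rw [abs_of_nonneg (hκ01 x).1]; exact (hκ01 x).2).mono_set hsub
  have iκ2 : IntegrableOn (fun x => A x * κ x ^ 2) (ball 0 ρ) :=
    (hI (C := 1) (hκm.pow_const 2) fun x => by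
      rw [abs_of_nonneg (sq_nonneg _)]
      exact pow_le_one₀ (hκ01 x).1 (hκ01 x).2).mono_set hsub
  rw [setIntegral_congr_set (ball_ae_eq_closedBall (by linarith))] at key
  have e0 : ∀ x, ‖gradient u x‖ ^ p * (‖x‖ ^ (-a) * V x) = A x * V x := fun x => by
    rw [hA]; ring
  replace key := key.trans_eq (integral_congr_ae (Eventually.of_forall e0))
  rw [← integral_inter_add_sdiff measurableSet_ball (hI hVm hVb),
    inter_eq_self_of_subset_right hsub] at key
  have hin : ∫ x in ball (0 : Euc n) ρ, A x * V x =
      -((n - p - a) * (∫ x in ball (0 : Euc n) ρ, A x)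
        + (p * a - a ^ 2 / 4) * (∫ x in ball (0 : Euc n) ρ, A x * κ x)
        - a ^ 2 / 4 * (p - 2) * (∫ x in ball (0 : Euc n) ρ, A x * κ x ^ 2)) := by
    have j1 := (iA.mono_set hsub).const_mul (n - p - a)
    have j2 := iκ.const_mul (p * a - a ^ 2 / 4)
    have j12 : IntegrableOn (fun x => (n - p - a) * A x + (p * a - a ^ 2 / 4) * (A x * κ x))
      (ball 0 ρ) := j1.add j2
    rw [← integral_const_mul, ← integral_const_mul, ← integral_const_mul, ← integral_add j1 j2,
      ← integral_sub j12 (iκ2.const_mul _), ← integral_neg]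
    refine integral_congr_ae ?_
    filter_upwards [ae_restrict_mem measurableSet_ball,
      ae_restrict_of_ae (Measure.ae_ne volume (0 : Euc n))] with x hx hx0
    obtain ⟨h1, h2⟩ := h.powerCutoffFactor_eq (a := a) hρ₀ hx0 hx
    simp only [hV, h1, h2, innerVariationWeight_one]
    ring
  have hout : ∫ x in ball (0 : Euc n) (3 * ρ / 2) \ ball 0 ρ, A x * V x ≤
      W * ∫ x in ball (0 : Euc n) (3 * ρ / 2) \ ball 0 ρ, A x := by
    rw [← integral_const_mul]
    refine integral_mono ((hI hVm hVb).mono_set sdiff_subset)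
      ((iA.mono_set sdiff_subset).const_mul W) fun x => ?_
    have hA0 : 0 ≤ A x := by positivity
    have := mul_le_mul_of_nonneg_left (le_of_abs_le (hVb x)) hA0
    simp only
    linarith
  have e1 : ∀ x, ‖x‖ ^ (-a) * ‖gradient u x‖ ^ (p - 2) * radialDeriv u x ^ 2 = A x * κ x :=
    fun x => by
    have := rpow_mul_div_pow (norm_nonneg _) (abs_radialDeriv_le u x) p two_ne_zero
    push_cast at this
    simp only [hA, hκ]
    rw [mul_assoc, mul_assoc, this]
  have e2 : ∀ x, ‖x‖ ^ (-a) * ‖gradient u x‖ ^ (p - 4) * radialDeriv u x ^ 4 =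
      A x * κ x ^ 2 := fun x => by
    have := rpow_mul_div_pow (norm_nonneg _) (abs_radialDeriv_le u x) p four_ne_zero
    push_cast at this
    simp only [hA, hκ]
    rw [mul_assoc, mul_assoc, ← pow_mul, this]
  simp only [e1, e2]
  linarith
end

/-- Lemma 2.6: for a stable regular solution `u` of `−Δ_p u = f(u)` in `B₁`
and any `a < n`, for every `ρ ∈ (0, 2/3)`,
`(n−p−a) ∫_{B_ρ} r^{−a}|∇u|^p + (pa − a²/4) ∫_{B_ρ} r^{−a}|∇u|^{p−2}u_r²
  − (a²/4)(p−2) ∫_{B_ρ} r^{−a}|∇u|^{p−4}u_r⁴ ≤ C ∫_{B_{3ρ/2}∖B_ρ} r^{−a}|∇u|^p`,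
where `C > 0` depends only on `n`, `p` and `a`. -/
theorem statement4 (n : ℕ) (p : ℝ) (hp : 1 < p) (a : ℝ) (ha : a < n) :
    ∃ C : ℝ, 0 < C ∧
      ∀ (f : ℝ → ℝ) (u : Euc n → ℝ), ContDiff ℝ 1 f →
        IsStableRegularSolution n p (ball 0 1) f u →
        ∀ ρ ∈ Ioo (0 : ℝ) (2 / 3),
          (n - p - a) * (∫ x in ball (0 : Euc n) ρ, ‖x‖ ^ (-a) * ‖gradient u x‖ ^ p)
            + (p * a - a ^ 2 / 4) *
                (∫ x in ball (0 : Euc n) ρ,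
                  ‖x‖ ^ (-a) * ‖gradient u x‖ ^ (p - 2) * radialDeriv u x ^ 2)
            - a ^ 2 / 4 * (p - 2) *
                (∫ x in ball (0 : Euc n) ρ,
                  ‖x‖ ^ (-a) * ‖gradient u x‖ ^ (p - 4) * radialDeriv u x ^ 4)
          ≤ C * ∫ x in ball (0 : Euc n) (3 * ρ / 2) \ ball (0 : Euc n) ρ,
              ‖x‖ ^ (-a) * ‖gradient u x‖ ^ p := by
  rcases eq_or_ne n 0 with rfl | hn
  · refine ⟨1, one_pos, fun f u _ _ ρ _ => ?_⟩
    have hg : ∀ x, gradient u x = 0 := fun x => Subsingleton.elim _ _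
    have hr : ∀ x, radialDeriv u x = 0 := fun x => by rw [radialDeriv, hg]; simp
    simp [hg, hr, Real.zero_rpow (by linarith : p ≠ 0)]
  · have : NeZero n := ⟨hn⟩
    obtain ⟨χ, χ', B, h⟩ := exists_isStepCutoff
    have hB : 0 ≤ B := (abs_nonneg _).trans (h.abs_mul_deriv_le 0)
    refine ⟨|p - n| + 2 * (|p| + 1) * (|a| / 2 + 2 * B) + (1 + |p - 2|) * (|a| / 2 + 2 * B) ^ 2 + 1,
      by positivity, fun f u hf hs ρ hρ => (hs.weighted_integral_le hp hf h ha hρ).trans ?_⟩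
    exact mul_le_mul_of_nonneg_right (by linarith) (integral_nonneg fun x => by positivity)
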